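/- For every K ∈ ℕ and every constant 0 < c < 1/2 there exist β > 0 and D₀ such that the following holds. Let G ∈ H(K) be a finite graph with δ(G) ≥ D₀, let x ∈ V(G), let p := 1/2 − c·√(log d(x)/d(x)), let A₀ be a p-random subset of V(G), and let (A_i) be the majority bootstrap percolation process started from A₀. Then Pr[x ∉ A₅] ≤ exp(−β·d(x)). -/

import Mathlib

open SimpleGraph Filter

namespace MBP

/-- Degree of a vertex, via the cardinality of its neighbourhood. -/
noncomputable def deg {V : Type} (G : SimpleGraph V) (x : V) : ℕ :=
  (G.neighborSet x).ncard

/-- Minimum degree. -/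
noncomputable def minDeg {V : Type} (G : SimpleGraph V) : ℕ :=
  sInf (Set.range (deg G))

/-- Maximum degree. -/
noncomputable def maxDeg {V : Type} (G : SimpleGraph V) : ℕ :=
  sSup (Set.range (deg G))

/-- Ball of radius `ℓ` around `x`. -/
def ball {V : Type} (G : SimpleGraph V) (x : V) (ℓ : ℕ) : Set V :=
  {y | G.edist x y ≤ ℓ}

/-- Sphere of radius `ℓ` around `x` (for `ℓ ≥ 1` this is `B(x,ℓ) \ B(x,ℓ-1)`). -/
def sphere {V : Type} (G : SimpleGraph V) (x : V) (ℓ : ℕ) : Set V :=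
  {y | G.edist x y = ℓ}

/-- (P1) locally K-almost regular. -/
def P1 (K : ℕ) {V : Type} (G : SimpleGraph V) : Prop :=
  ∀ (x : V) (ℓ : ℕ), 1 ≤ ℓ → ∀ y ∈ sphere G x ℓ,
    |(deg G x : ℤ) - (deg G y : ℤ)| ≤ (K : ℤ) * ℓ

/-- (P2) K-bounded backwards expansion. -/
def P2 (K : ℕ) {V : Type} (G : SimpleGraph V) : Prop :=
  ∀ (x : V) (ℓ : ℕ), 1 ≤ ℓ → ∀ y ∈ sphere G x ℓ,
    (G.neighborSet y ∩ ball G x ℓ).ncard ≤ K * ℓ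

/-- `D` witnesses property (P3) (typical local structure and K-separation) at vertex `x`. -/
def P3At (K : ℕ) {V : Type} (G : SimpleGraph V) (x : V) (D : Set V) : Prop :=
  x ∉ D ∧ ∀ (ℓ : ℕ), 1 ≤ ℓ →
    ((D ∩ sphere G x ℓ).ncard ≤ K ^ (ℓ - 1) * (deg G x) ^ (ℓ - 1)) ∧
    (∀ y ∈ sphere G x ℓ \ D, (D ∩ G.neighborSet y).ncard ≤ K * ℓ) ∧
    (∀ y ∈ sphere G x ℓ \ D, ∀ z ∈ sphere G x ℓ \ D, y ≠ z →
      (G.neighborSet y ∩ G.neighborSet z ∩ (sphere G x (ℓ + 1) \ D)).ncard ≤ 1) ∧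
    (∀ y ∈ sphere G x ℓ \ D,
      (ball G y (2 * ℓ - 1) ∩ (sphere G x ℓ \ D)).ncard ≤ ℓ * K ^ (ℓ - 1) * (deg G x) ^ (ℓ - 1))

/-- (P3) typical local structure and K-separation. -/
def P3 (K : ℕ) {V : Type} (G : SimpleGraph V) : Prop :=
  ∀ x : V, ∃ D : Set V, P3At K G x D

/-- (P5) exponential order. -/
def P5 (K : ℕ) {V : Type} (G : SimpleGraph V) : Prop :=
  (Nat.card V : ℝ) ≤ Real.exp (K * minDeg G)

/-- (P4) K-projection, relative to a membership predicate `mem` for the projected subgraphs. -/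
def P4With (K : ℕ) {V : Type} (G : SimpleGraph V) (mem : G.Subgraph → Prop) : Prop :=
  ∀ (x : V) (ℓ : ℕ), 1 ≤ ℓ → ∀ y ∈ sphere G x ℓ,
    ∃ H : G.Subgraph, y ∈ H.verts ∧ mem H ∧
      H.verts ∩ ball G x (ℓ - 1) = ∅ ∧
      ∀ w : H.verts, |(deg H.coe w : ℤ) - (deg G (w : V) : ℤ)| ≤ (K : ℤ) * ℓ

/-- Membership in the class H(K) with recursion fuel `n`. -/
def HAux (K : ℕ) : ℕ → (V : Type) → SimpleGraph V → Prop
  | 0, V, _ => Nat.card V = 1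
  | n + 1, V, G =>
      Nat.card V = 1 ∨
        (P1 K G ∧ P2 K G ∧ P3 K G ∧ P4With K G (fun H => HAux K n H.verts H.coe) ∧ P5 K G)

/-- The class `H(K)` of geometric graphs: least class containing the one-vertex graph and
closed under properties (P1)–(P5), where the projections of (P4) again lie in the class. -/
def InH (K : ℕ) {V : Type} (G : SimpleGraph V) : Prop :=
  ∃ n, HAux K n V G

/-- One round of majority bootstrap percolation: a vertex `v` becomes infected if at least
`d(v)/2` of its neighbours are infected. -/
def bootStep {V : Type} (G : SimpleGraph V) (A : Set V) : Set V :=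
  A ∪ {v | (deg G v : ℝ) / 2 ≤ ((G.neighborSet v ∩ A).ncard : ℝ)}

/-- The majority bootstrap percolation process. -/
def bootIter {V : Type} (G : SimpleGraph V) (A0 : Set V) : ℕ → Set V
  | 0 => A0
  | n + 1 => bootStep G (bootIter G A0 n)

/-- `A0` percolates if eventually every vertex is infected. -/
def Percolates {V : Type} (G : SimpleGraph V) (A0 : Set V) : Prop :=
  (⋃ i, bootIter G A0 i) = Set.univ

/-- Weight of a subset `A` under the `p`-random measure. -/
noncomputable def weight {V : Type} (p : ℝ) (A : Set V) : ℝ :=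
  p ^ A.ncard * (1 - p) ^ (Aᶜ).ncard

/-- Probability that a `p`-random subset of `V` satisfies the event `E`. -/
noncomputable def prob {V : Type} (p : ℝ) (E : Set V → Prop) : ℝ :=
  ∑ᶠ A ∈ {A : Set V | E A}, weight p A

/-- Probability that a `p`-random initial set percolates. -/
noncomputable def Phi {V : Type} (p : ℝ) (G : SimpleGraph V) : ℝ :=
  prob p (fun A0 => Percolates G A0)

/-- One round of the `m`-shifted bootstrap process (threshold `d(v)/2 + m`). -/
def bootStepM {V : Type} (G : SimpleGraph V) (m : ℕ) (A : Set V) : Set V :=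
  A ∪ {v | (deg G v : ℝ) / 2 + m ≤ ((G.neighborSet v ∩ A).ncard : ℝ)}

/-- The `m`-shifted bootstrap process. -/
def bootIterM {V : Type} (G : SimpleGraph V) (m : ℕ) (A0 : Set V) : ℕ → Set V
  | 0 => A0
  | n + 1 => bootStepM G m (bootIterM G m A0 n)

/-- `σ(x) = √(log d(x) / d(x))`. -/
noncomputable def sigma' {V : Type} (G : SimpleGraph V) (x : V) : ℝ :=
  Real.sqrt (Real.log (deg G x) / (deg G x))

/-- `γ(x) = √(d(x) / √(log d(x)))`. -/
noncomputable def gamma' {V : Type} (G : SimpleGraph V) (x : V) : ℝ :=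
  Real.sqrt ((deg G x : ℝ) / Real.sqrt (Real.log (deg G x)))

/-- The `Boot₂(γ)` process: in the step from round `ℓ` to round `ℓ+1`, a vertex `v` becomes
infected if at least `d(v)/2 - max(0, 2-ℓ)·γ(v)` of its neighbours are infected. -/
noncomputable def hatIter {V : Type} (G : SimpleGraph V) (A0 : Set V) : ℕ → Set V
  | 0 => A0
  | ℓ + 1 =>
      hatIter G A0 ℓ ∪
        {v | (deg G v : ℝ) / 2 - ((2 - ℓ : ℕ) : ℝ) * gamma' G v
              ≤ ((G.neighborSet v ∩ hatIter G A0 ℓ).ncard : ℝ)}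

/-- Expectation of `f` restricted to the event `E`, under the `p`-random measure. -/
noncomputable def expOn {V : Type} (p : ℝ) (E : Set V → Prop) (f : Set V → ℝ) : ℝ :=
  ∑ᶠ A ∈ {A : Set V | E A}, weight p A * f A

/-- Conditional expectation of `f` given the event `E`. -/
noncomputable def condExp {V : Type} (p : ℝ) (E : Set V → Prop) (f : Set V → ℝ) : ℝ :=
  expOn p E f / prob p E

/-- Conditional variance of `f` given the event `E`. -/
noncomputable def condVar {V : Type} (p : ℝ) (E : Set V → Prop) (f : Set V → ℝ) : ℝ :=
  condExp p E (fun A => (f A - condExp p E f) ^ 2)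

/-- The number of edges between `U` and `W` (ordered pairs `(u,w)` with `u ∈ U`, `w ∈ W`
adjacent; for disjoint sets this is the number of edges with one endpoint in each). -/
noncomputable def eBetween {V : Type} (G : SimpleGraph V) (U W : Set V) : ℕ :=
  {e : V × V | e.1 ∈ U ∧ e.2 ∈ W ∧ G.Adj e.1 e.2}.ncard

/-- Upper tail `Pr[Bin(d,p) ≥ t]` of the binomial distribution. -/
noncomputable def binTail (d : ℕ) (p : ℝ) (t : ℝ) : ℝ :=
  ∑ k ∈ Finset.range (d + 1),
    if t ≤ (k : ℝ) then (d.choose k : ℝ) * p ^ k * (1 - p) ^ (d - k) else 0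

section Framework
open Finset

/-- Expectation of `f` over a `p`-random subset of the finite set `S`. -/
noncomputable def Ex {V : Type} (p : ℝ) (S : Finset V) (f : Finset V → ℝ) : ℝ :=
  ∑ A ∈ S.powerset, p ^ (#A) * (1 - p) ^ (#S - #A) * f A

variable {V : Type}

theorem Ex_mono {p : ℝ} (h0 : 0 ≤ p) (h1 : p ≤ 1) (S : Finset V) {f g : Finset V → ℝ}
    (h : ∀ A, f A ≤ g A) : Ex p S f ≤ Ex p S g := by
  unfold Ex
  refine Finset.sum_le_sum fun A _ => ?_
  have : 0 ≤ 1 - p := by linarith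
  exact mul_le_mul_of_nonneg_left (h A) (by positivity)

theorem Ex_const (p : ℝ) (S : Finset V) (a : ℝ) : Ex p S (fun _ => a) = a := by
  unfold Ex
  rw [← Finset.sum_mul, Finset.sum_pow_mul_eq_add_pow]
  simp

theorem Ex_nonneg {p : ℝ} (h0 : 0 ≤ p) (h1 : p ≤ 1) (S : Finset V) {f : Finset V → ℝ}
    (h : ∀ A, 0 ≤ f A) : 0 ≤ Ex p S f := by
  have := Ex_mono h0 h1 S h
  rwa [Ex_const] at this

theorem Ex_add (p : ℝ) (S : Finset V) (f g : Finset V → ℝ) :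
    Ex p S (fun A => f A + g A) = Ex p S f + Ex p S g := by
  unfold Ex
  rw [← Finset.sum_add_distrib]
  refine Finset.sum_congr rfl fun A _ => by ring

theorem Ex_mul (p : ℝ) (S : Finset V) (a : ℝ) (f : Finset V → ℝ) :
    Ex p S (fun A => a * f A) = a * Ex p S f := by
  unfold Ex
  rw [Finset.mul_sum]
  refine Finset.sum_congr rfl fun A _ => by ring

theorem Ex_sum {ι : Type*} (p : ℝ) (S : Finset V) (I : Finset ι) (f : ι → Finset V → ℝ) :
    Ex p S (fun A => ∑ i ∈ I, f i A) = ∑ i ∈ I, Ex p S (f i) := by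
  unfold Ex
  rw [Finset.sum_comm]
  refine Finset.sum_congr rfl fun A _ => by rw [Finset.mul_sum]

variable [DecidableEq V]

theorem Ex_union (p : ℝ) {S T : Finset V} (h : Disjoint S T) (f : Finset V → ℝ) :
    Ex p (S ∪ T) f = Ex p S (fun A => Ex p T (fun B => f (A ∪ B))) := by
  unfold Ex
  simp_rw [Finset.mul_sum]
  rw [← Finset.sum_product']
  refine Finset.sum_nbij' (fun C => (C ∩ S, C ∩ T)) (fun AB => AB.1 ∪ AB.2) ?_ ?_ ?_ ?_ ?_
  · intro C hC
    simp
  · intro AB hAB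
    simp only [mem_product, mem_powerset] at hAB ⊢
    exact Finset.union_subset_union hAB.1 hAB.2
  · intro C hC
    simp only [mem_powerset] at hC
    simp only
    rw [← Finset.inter_union_distrib_left]
    exact Finset.inter_eq_left.2 hC
  · rintro ⟨A, B⟩ hAB
    simp only [mem_product, mem_powerset] at hAB
    obtain ⟨hA, hB⟩ := hAB
    rw [Finset.disjoint_left] at h
    ext a
    · simp only [mem_inter, mem_union]
      constructor
      · rintro ⟨h1 | h1, h2⟩
        · exact h1
        · exact absurd (hB h1) (h h2)
      · intro h1; exact ⟨Or.inl h1, hA h1⟩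
    · simp only [mem_inter, mem_union]
      constructor
      · rintro ⟨h1 | h1, h2⟩
        · exact absurd h2 (h (hA h1))
        · exact h1
      · intro h1; exact ⟨Or.inr h1, hB h1⟩
  · intro C hC
    simp only [mem_powerset] at hC
    have hd : Disjoint (C ∩ S) (C ∩ T) :=
      Finset.disjoint_of_subset_left Finset.inter_subset_right
        (Finset.disjoint_of_subset_right Finset.inter_subset_right h)
    have hCe : C ∩ S ∪ C ∩ T = C := by
      rw [← Finset.inter_union_distrib_left]; exact Finset.inter_eq_left.2 hC
    have hc : #C = #(C ∩ S) + #(C ∩ T) := by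
      rw [← Finset.card_union_of_disjoint hd, hCe]
    have hST : #(S ∪ T) = #S + #T := Finset.card_union_of_disjoint h
    have h1 : #(C ∩ S) ≤ #S := Finset.card_le_card Finset.inter_subset_right
    have h2 : #(C ∩ T) ≤ #T := Finset.card_le_card Finset.inter_subset_right
    simp only [hCe]
    rw [hc, hST, show #S + #T - (#(C ∩ S) + #(C ∩ T)) = (#S - #(C ∩ S)) + (#T - #(C ∩ T)) by omega,
      pow_add, pow_add]
    ring

/-- `f` depends only on the intersection with `S`. -/
def Loc (S : Finset V) (f : Finset V → ℝ) : Prop := ∀ A, f A = f (A ∩ S)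

theorem Loc.eq {S : Finset V} {f : Finset V → ℝ} (h : Loc S f) {A B : Finset V}
    (hAB : A ∩ S = B ∩ S) : f A = f B := by
  rw [h A, h B, hAB]

theorem Loc.mono {S T : Finset V} {f : Finset V → ℝ} (h : Loc S f) (hST : S ⊆ T) : Loc T f := by
  intro A
  apply h.eq
  rw [Finset.inter_assoc, Finset.inter_eq_right.2 hST]

theorem Ex_loc [Fintype V] (p : ℝ) {S : Finset V} {f : Finset V → ℝ} (h : Loc S f) :
    Ex p univ f = Ex p S f := by
  have hu : (univ : Finset V) = S ∪ Sᶜ := by simp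
  have hd : Disjoint S Sᶜ := disjoint_compl_right
  rw [hu, Ex_union p hd]
  unfold Ex
  refine Finset.sum_congr rfl fun A hA => ?_
  congr 1
  have h2 : ∀ B ∈ Sᶜ.powerset, f (A ∪ B) = f A := by
    intro B hB
    apply h.eq
    ext a
    simp only [mem_powerset, mem_inter, mem_union] at *
    constructor
    · rintro ⟨h1 | h1, h3⟩
      · exact ⟨h1, h3⟩
      · have := hB h1
        simp at this
        exact absurd h3 this
    · rintro ⟨h1, h3⟩; exact ⟨Or.inl h1, h3⟩
  beta_reduce
  rw [Finset.sum_congr rfl (fun B hB => by rw [h2 B hB]), ← Finset.sum_mul,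
    Finset.sum_pow_mul_eq_add_pow]
  simp

theorem Ex_indep [Fintype V] (p : ℝ) {S T : Finset V} {f g : Finset V → ℝ} (hf : Loc S f)
    (hg : Loc T g) (hST : Disjoint S T) :
    Ex p univ (fun A => f A * g A) = Ex p univ f * Ex p univ g := by
  have hl : Loc (S ∪ T) (fun A => f A * g A) := by
    intro A
    have h1 := (hf.mono (Finset.subset_union_left (s₂ := T))) A
    have h2 := (hg.mono (Finset.subset_union_right (s₁ := S))) A
    simp only
    rw [← h1, ← h2]
  rw [Ex_loc p hl, Ex_union p hST, Ex_loc p hf, Ex_loc p hg]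
  rw [Finset.disjoint_left] at hST
  unfold Ex
  rw [Finset.sum_mul]
  refine Finset.sum_congr rfl fun A hA => ?_
  beta_reduce
  rw [mul_assoc (p ^ #A * (1 - p) ^ (#S - #A)) (f A)]
  congr 1
  rw [Finset.mul_sum]
  refine Finset.sum_congr rfl fun B hB => ?_
  simp only [mem_powerset] at hA hB
  have e1 : f (A ∪ B) = f A := by
    apply hf.eq
    ext a
    simp only [mem_inter, mem_union]
    constructor
    · rintro ⟨h1 | h1, h3⟩
      · exact ⟨h1, h3⟩
      · exact absurd (hB h1) (hST h3)
    · rintro ⟨h1, h3⟩; exact ⟨Or.inl h1, h3⟩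
  have e2 : g (A ∪ B) = g B := by
    apply hg.eq
    ext a
    simp only [mem_inter, mem_union]
    constructor
    · rintro ⟨h1 | h1, h3⟩
      · exact absurd h3 (hST (hA h1))
      · exact ⟨h1, h3⟩
    · rintro ⟨h1, h3⟩; exact ⟨Or.inr h1, h3⟩
  rw [e1, e2]
  ring

theorem Loc_prod {ι : Type*} [DecidableEq ι] (I : Finset ι) (S : ι → Finset V)
    (f : ι → Finset V → ℝ) (h : ∀ i ∈ I, Loc (S i) (f i)) :
    Loc (I.biUnion S) (fun A => ∏ i ∈ I, f i A) := by
  intro A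
  refine Finset.prod_congr rfl fun i hi => ?_
  exact (h i hi).mono (Finset.subset_biUnion_of_mem S hi) A

theorem Ex_prod [Fintype V] {ι : Type*} [DecidableEq ι] (p : ℝ) (I : Finset ι) (S : ι → Finset V)
    (f : ι → Finset V → ℝ) (h : ∀ i ∈ I, Loc (S i) (f i))
    (hd : ∀ i ∈ I, ∀ j ∈ I, i ≠ j → Disjoint (S i) (S j)) :
    Ex p univ (fun A => ∏ i ∈ I, f i A) = ∏ i ∈ I, Ex p univ (f i) := by
  induction I using Finset.induction_on with
  | empty => simp [Ex_const]
  | insert a I ha ih =>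
    simp_rw [Finset.prod_insert ha]
    rw [Ex_indep p (h a (Finset.mem_insert_self _ _))
      (Loc_prod I S f (fun i hi => h i (Finset.mem_insert_of_mem hi))), ih]
    · intro i hi; exact h i (Finset.mem_insert_of_mem hi)
    · intro i hi j hj; exact hd i (Finset.mem_insert_of_mem hi) j (Finset.mem_insert_of_mem hj)
    · rw [Finset.disjoint_biUnion_right]
      intro i hi
      exact hd a (Finset.mem_insert_self _ _) i (Finset.mem_insert_of_mem hi)
        (fun h => ha (h ▸ hi))

/-- Point mass of the binomial distribution. -/
noncomputable def bn (m : ℕ) (p : ℝ) (k : ℕ) : ℝ := (m.choose k : ℝ) * p ^ k * (1 - p) ^ (m - k)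

theorem Ex_card [Fintype V] (p : ℝ) (S : Finset V) (h : ℕ → ℝ) :
    Ex p univ (fun A => h (#(S ∩ A))) = ∑ k ∈ range (#S + 1), bn (#S) p k * h k := by
  have hl : Loc S (fun A => h (#(S ∩ A))) := by
    intro A
    simp only
    congr 2
    ext a; simp only [mem_inter]; tauto
  rw [Ex_loc p hl]
  unfold Ex bn
  have : ∀ A ∈ S.powerset, p ^ (#A) * (1 - p) ^ (#S - #A) * h (#(S ∩ A)) =
      (fun k => p ^ k * (1 - p) ^ (#S - k) * h k) (#A) := by
    intro A hA
    simp only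
    rw [Finset.inter_eq_right.2 (Finset.mem_powerset.1 hA)]
  rw [Finset.sum_congr rfl this,
    Finset.sum_powerset_apply_card (fun k => p ^ k * (1 - p) ^ (#S - k) * h k)]
  refine Finset.sum_congr rfl fun k _ => ?_
  simp only [nsmul_eq_mul]
  ring

theorem prob_eq [Fintype V] (p : ℝ) (E : Set V → Prop) 
    [∀ A : Finset V, Decidable (E (↑A : Set V))] :
    prob p E = Ex p univ (fun A : Finset V => if E (↑A : Set V) then 1 else 0) := by
  unfold prob Ex
  have e1 : ∑ᶠ A ∈ {A : Set V | E A}, weight p A =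
      ∑ᶠ A : Finset V, (if E (↑A : Set V) then weight p (↑A : Set V) else 0) := by
    rw [← finsum_comp_equiv (Fintype.finsetEquivSet (α := V))]
    refine finsum_congr fun A => ?_
    simp only [Set.mem_ofPred_eq, Fintype.coe_finsetEquivSet]
    by_cases hE : E (↑A : Set V) <;> simp [hE]
  rw [e1, finsum_eq_sum_of_fintype, Finset.powerset_univ]
  refine Finset.sum_congr rfl fun A _ => ?_
  unfold weight
  by_cases hE : E (↑A : Set V)
  · simp only [hE, if_true, mul_one]
    rw [Set.ncard_coe_finset, ← Finset.coe_compl, Set.ncard_coe_finset, Finset.card_compl,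
      Finset.card_univ]
  · simp [hE]

end Framework

section Binomial
open Finset

/-- Upper tail of the binomial distribution. -/
noncomputable def tl (m : ℕ) (p : ℝ) (t : ℕ) : ℝ :=
  ∑ k ∈ range (m + 1), if t ≤ k then bn m p k else 0

theorem bn_nonneg {p : ℝ} (h0 : 0 ≤ p) (h1 : p ≤ 1) (m k : ℕ) : 0 ≤ bn m p k := by
  unfold bn
  have : 0 ≤ 1 - p := by linarith
  positivity

theorem bn_var (m : ℕ) (p : ℝ) :
    ∑ k ∈ range (m + 1), bn m p k * ((k : ℝ) - m * p) ^ 2 = m * p * (1 - p) := by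
  have h := congrArg (Polynomial.eval p) (bernsteinPolynomial.variance (R := ℝ) m)
  simp only [Polynomial.eval_finsetSum, bernsteinPolynomial, Polynomial.eval_mul,
    Polynomial.eval_pow, Polynomial.eval_sub, nsmul_eq_mul, Polynomial.eval_natCast,
    Polynomial.eval_X, Polynomial.eval_one] at h
  rw [← h]
  refine Finset.sum_congr rfl fun k _ => ?_
  unfold bn
  ring

theorem tl_anti {p : ℝ} (h0 : 0 ≤ p) (h1 : p ≤ 1) (m : ℕ) {s t : ℕ} (hst : s ≤ t) :
    tl m p t ≤ tl m p s := by
  unfold tl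
  refine Finset.sum_le_sum fun k _ => ?_
  have := bn_nonneg h0 h1 m k
  split_ifs <;> first | omega | linarith

theorem tl_nonneg {p : ℝ} (h0 : 0 ≤ p) (h1 : p ≤ 1) (m t : ℕ) : 0 ≤ tl m p t := by
  unfold tl
  refine Finset.sum_nonneg fun k _ => ?_
  have := bn_nonneg h0 h1 m k
  split_ifs <;> linarith

theorem tl_succ (m : ℕ) (p : ℝ) {t : ℕ} (ht : t ≤ m) : tl m p t = bn m p t + tl m p (t + 1) := by
  unfold tl
  have : ∀ k ∈ range (m + 1), (if t ≤ k then bn m p k else 0) =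
      (if k = t then bn m p k else 0) + (if t + 1 ≤ k then bn m p k else 0) := by
    intro k _
    split_ifs <;> first | omega | simp
  rw [Finset.sum_congr rfl this, Finset.sum_add_distrib]
  congr 1
  rw [Finset.sum_ite_eq' (range (m + 1)) t, if_pos (by simp; omega)]

theorem bn_ratio {p r : ℝ} (h0 : 0 ≤ p) (h1 : p < 1) {m k : ℕ} (hk : k < m)
    (h : r * ((k + 1) * (1 - p)) ≤ ((m : ℝ) - k) * p) : r * bn m p k ≤ bn m p (k + 1) := by
  have hq : 0 < 1 - p := by linarith
  have hpos : (0 : ℝ) < (k + 1) * (1 - p) := by positivity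
  have key : bn m p (k + 1) * ((k + 1) * (1 - p)) = bn m p k * (((m : ℝ) - k) * p) := by
    unfold bn
    have hc : (m.choose (k + 1) : ℝ) * (k + 1) = (m.choose k : ℝ) * ((m : ℝ) - k) := by
      have := Nat.choose_succ_right_eq m k
      have h2 : ((m - k : ℕ) : ℝ) = (m : ℝ) - k := by
        rw [Nat.cast_sub hk.le]
      rw [← h2]
      exact_mod_cast this
    have he : m - k = (m - (k + 1)) + 1 := by omega
    rw [he, pow_succ (1 - p), pow_succ p]
    linear_combination (p ^ k * p * (1 - p) ^ (m - (k + 1)) * (1 - p)) * hc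
  have hb := bn_nonneg h0 h1.le m k
  have : r * bn m p k * ((k + 1) * (1 - p)) ≤ bn m p (k + 1) * ((k + 1) * (1 - p)) := by
    rw [key]
    nlinarith
  exact le_of_mul_le_mul_right this hpos

theorem tl_ratio {p : ℝ} (h0 : 0 ≤ p) (h1 : p < 1) {m k T : ℕ} (hT : 1 ≤ T) (hk : k + T ≤ m)
    (h : ∀ j, k ≤ j → j < k + T → (1 - 1 / (2 * T) : ℝ) * ((j + 1) * (1 - p)) ≤ ((m : ℝ) - j) * p) :
    bn m p k * (T / 2) ≤ tl m p (k + 1) := by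
  have hT' : (1 : ℝ) ≤ T := by exact_mod_cast hT
  have hb := bn_nonneg h0 h1.le m k
  have step : ∀ i, i ≤ T → (1 - i / (2 * T) : ℝ) * bn m p k ≤ bn m p (k + i) := by
    intro i
    induction i with
    | zero => simp
    | succ i ih =>
      intro hi
      have h3 := ih (by omega)
      have h4 := bn_ratio h0 h1 (by omega) (h (k + i) (by omega) (by omega))
      refine le_trans ?_ h4
      have hr : (0 : ℝ) ≤ 1 - 1 / (2 * T) := by
        rw [sub_nonneg, div_le_one (by positivity)]; linarith
      refine le_trans ?_ (mul_le_mul_of_nonneg_left h3 hr)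
      rw [← mul_assoc]
      refine mul_le_mul_of_nonneg_right ?_ hb
      push_cast
      have : (0 : ℝ) ≤ (1 / (2 * T)) * (i / (2 * T)) := by positivity
      have e : ((i : ℝ) + 1) / (2 * T) = i / (2 * T) + 1 / (2 * T) := by ring
      rw [e]
      nlinarith
  have hs : ∑ i ∈ range T, bn m p (k + 1 + i) ≤ tl m p (k + 1) := by
    have e : ∑ i ∈ range T, bn m p (k + 1 + i) = ∑ j ∈ Ico (k + 1) (k + 1 + T), bn m p j := by
      rw [Finset.sum_Ico_eq_sum_range]; congr 2; omega
    rw [e]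
    unfold tl
    rw [← Finset.sum_filter]
    refine Finset.sum_le_sum_of_subset_of_nonneg ?_ fun j _ _ => bn_nonneg h0 h1.le m j
    intro j hj
    simp only [mem_Ico, mem_filter, mem_range] at *
    omega
  refine le_trans ?_ hs
  have : ∀ i ∈ range T, (1 / 2 : ℝ) * bn m p k ≤ bn m p (k + 1 + i) := by
    intro i hi
    have hi' : i + 1 ≤ T := by simpa using hi
    have := step (i + 1) hi'
    rw [show k + 1 + i = k + (i + 1) by ring]
    refine le_trans (mul_le_mul_of_nonneg_right ?_ hb) this
    have h5 : ((i + 1 : ℕ) : ℝ) / (2 * T) ≤ 1 / 2 := by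
      rw [div_le_div_iff₀ (by positivity) (by norm_num)]
      have : ((i + 1 : ℕ) : ℝ) ≤ T := by exact_mod_cast hi'
      linarith
    linarith
  have h6 := Finset.sum_le_sum this
  rw [Finset.sum_const, card_range, nsmul_eq_mul] at h6
  linarith

/-- A uniform version. -/
theorem tl_ratio' {p : ℝ} (h0 : 0 ≤ p) (h1 : p < 1) {m T C : ℕ} (hT : 1 ≤ T)
    (hm : C + 2 * T ≤ m)
    (h : (1 - 1 / (2 * T) : ℝ) * (((m : ℝ) / 2 + C + T + 1) * (1 - p)) ≤ ((m : ℝ) / 2 - C - T) * p)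
    {k : ℕ} (hk : 2 * k ≤ m + C) : tl m p k ≤ (1 + 2 / T) * tl m p (k + 1) := by
  have hT' : (1 : ℝ) ≤ T := by exact_mod_cast hT
  have hkR : (2 : ℝ) * k ≤ m + C := by exact_mod_cast hk
  have hr : (0 : ℝ) ≤ 1 - 1 / (2 * T) := by
    rw [sub_nonneg, div_le_one (by positivity)]; linarith
  have key := tl_ratio h0 h1 (m := m) (k := k) hT (by omega) (by
    intro j hj1 hj2
    have hj3 : (j : ℝ) ≤ k + T := by exact_mod_cast hj2.le
    have hC : (0 : ℝ) ≤ C := by positivity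
    refine le_trans (mul_le_mul_of_nonneg_left
      (mul_le_mul_of_nonneg_right ?_ (by linarith)) hr) (le_trans h
        (mul_le_mul_of_nonneg_right ?_ h0))
    · linarith
    · linarith)
  rw [tl_succ m p (by omega)]
  have : bn m p k ≤ 2 / T * tl m p (k + 1) := by
    rw [div_mul_eq_mul_div, le_div_iff₀ (by linarith)]
    linarith
  linarith

theorem half_sum (m : ℕ) : (2 : ℝ) ^ m / 2 ≤
    ∑ k ∈ range (m + 1), if m ≤ 2 * k then (m.choose k : ℝ) else 0 := by
  have h1 : ∑ k ∈ range (m + 1), (m.choose k : ℝ) = 2 ^ m := by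
    exact_mod_cast Nat.sum_range_choose m
  have h2 : (∑ k ∈ range (m + 1), if 2 * k ≤ m then (m.choose k : ℝ) else 0) =
      ∑ k ∈ range (m + 1), if m ≤ 2 * k then (m.choose k : ℝ) else 0 := by
    rw [← Finset.sum_range_reflect]
    refine Finset.sum_congr rfl fun k hk => ?_
    have hk' : k ≤ m := by simpa [Nat.lt_succ_iff] using hk
    rw [show m + 1 - 1 - k = m - k by omega, Nat.choose_symm hk']
    have : 2 * (m - k) ≤ m ↔ m ≤ 2 * k := by omega
    simp only [this]
  have h3 : ∑ k ∈ range (m + 1), (m.choose k : ℝ) ≤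
      (∑ k ∈ range (m + 1), if 2 * k ≤ m then (m.choose k : ℝ) else 0) +
      ∑ k ∈ range (m + 1), if m ≤ 2 * k then (m.choose k : ℝ) else 0 := by
    rw [← Finset.sum_add_distrib]
    refine Finset.sum_le_sum fun k _ => ?_
    have : (0 : ℝ) ≤ m.choose k := by positivity
    split_ifs <;> first | omega | linarith
  rw [h2, h1] at h3
  linarith

theorem window_sum {m : ℕ} (hm : 1 ≤ m) : (2 : ℝ) ^ m / 4 ≤
    ∑ k ∈ range (m + 1), if m ≤ 2 * k ∧ (k : ℝ) ≤ m / 2 + Real.sqrt m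
      then (m.choose k : ℝ) else 0 := by
  have hv := bn_var m (1 / 2)
  have hmR : (1 : ℝ) ≤ m := by exact_mod_cast hm
  have hv' : ∑ k ∈ range (m + 1), (m.choose k : ℝ) * ((k : ℝ) - m / 2) ^ 2 =
      (2 : ℝ) ^ m * ((m : ℝ) / 4) := by
    have : ∀ k ∈ range (m + 1), bn m (1 / 2) k * ((k : ℝ) - m * (1 / 2)) ^ 2 =
        (1 / 2) ^ m * ((m.choose k : ℝ) * ((k : ℝ) - m / 2) ^ 2) := by
      intro k hk
      have hk' : k ≤ m := by simpa [Nat.lt_succ_iff] using hk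
      unfold bn
      have e : (1 / 2 : ℝ) ^ m = (1 / 2) ^ k * (1 / 2) ^ (m - k) := by
        rw [← pow_add]; congr 1; omega
      rw [e, show (1 - 1 / 2 : ℝ) = 1 / 2 by norm_num]
      ring
    rw [Finset.sum_congr rfl this, ← Finset.mul_sum] at hv
    have e2 : (2 : ℝ) ^ m * (1 / 2) ^ m = 1 := by rw [← mul_pow]; norm_num
    calc _ = (2 : ℝ) ^ m * (1 / 2) ^ m * ∑ k ∈ range (m + 1), (m.choose k : ℝ) * ((k : ℝ) - m / 2) ^ 2 := by
            rw [e2, one_mul]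
      _ = _ := by rw [mul_assoc, hv]; ring
  have h1 := half_sum m
  have h2 : ∑ k ∈ range (m + 1), (if m ≤ 2 * k then (m.choose k : ℝ) else 0) ≤
      (∑ k ∈ range (m + 1), if m ≤ 2 * k ∧ (k : ℝ) ≤ m / 2 + Real.sqrt m
      then (m.choose k : ℝ) else 0) +
      ∑ k ∈ range (m + 1), (1 / m : ℝ) * ((m.choose k : ℝ) * ((k : ℝ) - m / 2) ^ 2) := by
    rw [← Finset.sum_add_distrib]
    refine Finset.sum_le_sum fun k _ => ?_
    have hc : (0 : ℝ) ≤ m.choose k := by positivity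
    have h3 : (0 : ℝ) ≤ (1 / m : ℝ) * ((m.choose k : ℝ) * ((k : ℝ) - m / 2) ^ 2) := by positivity
    by_cases hA : m ≤ 2 * k
    · by_cases hB : (k : ℝ) ≤ m / 2 + Real.sqrt m
      · simp only [hA, hB, and_self, if_true]; linarith
      · simp only [hA, hB, and_false, if_true, if_false]
        push Not at hB
        have h5 : (m : ℝ) ≤ ((k : ℝ) - m / 2) ^ 2 := by
          have h6 : Real.sqrt m ^ 2 = m := Real.sq_sqrt (by positivity)
          have := Real.sqrt_nonneg (m : ℝ)
          nlinarith
        have h7 : (1 : ℝ) ≤ (1 / m : ℝ) * ((k : ℝ) - m / 2) ^ 2 := by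
          rw [div_mul_eq_mul_div, le_div_iff₀ (by linarith)]; linarith
        nlinarith
    · simp only [hA, false_and, if_false]; linarith
  rw [← Finset.mul_sum, hv'] at h2
  have h8 : (1 / m : ℝ) * (2 ^ m * (m / 4)) = 2 ^ m / 4 := by
    field_simp
  linarith

theorem log_one_sub_ge {u : ℝ} (h0 : 0 ≤ u) (h1 : u ≤ 1 / 2) : -u - u ^ 2 ≤ Real.log (1 - u) := by
  have h2 : 0 < 1 - u := by linarith
  rw [Real.le_log_iff_exp_le h2]
  have h3 : Real.exp (-u - u ^ 2) = (Real.exp (u + u ^ 2))⁻¹ := by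
    rw [← Real.exp_neg]; congr 1; ring
  rw [h3]
  have h4 := Real.quadratic_le_exp_of_nonneg (x := u + u ^ 2) (by positivity)
  rw [inv_le_comm₀ (Real.exp_pos _) h2]
  refine le_trans ?_ h4
  rw [inv_le_iff_one_le_mul₀ h2]
  have h5 : 0 ≤ u ^ 2 * (1 - u - u ^ 2 - u ^ 3) := by
    apply mul_nonneg (by positivity)
    nlinarith [mul_nonneg h0 h0, mul_nonneg (mul_nonneg h0 h0) h0]
  nlinarith

theorem tl_lower {m : ℕ} (hm : 1 ≤ m) {δ : ℝ} (h0 : 0 ≤ δ) (h1 : δ ≤ 1 / 8) :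
    Real.exp (-(2 * m * δ ^ 2 + 8 * m * δ ^ 4 + 6 * δ * Real.sqrt m)) / 4 ≤
      tl m (1 / 2 - δ) ((m + 1) / 2) := by
  have hw := window_sum hm
  have hs := Real.sqrt_nonneg (m : ℝ)
  have e2 : (1 / 2 : ℝ) ^ m * 2 ^ m = 1 := by rw [← mul_pow]; norm_num
  set ρ := Real.exp (-(2 * m * δ ^ 2 + 8 * m * δ ^ 4 + 6 * δ * Real.sqrt m)) with hρ
  have hρ0 : 0 < ρ := Real.exp_pos _
  have hp0 : (0 : ℝ) < 1 - 2 * δ := by linarith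
  have hp1 : (0 : ℝ) < 1 + 2 * δ := by linarith
  have hterm : ∀ k ∈ range (m + 1), m ≤ 2 * k → (k : ℝ) ≤ m / 2 + Real.sqrt m →
      (1 / 2) ^ m * ρ * (m.choose k : ℝ) ≤ bn m (1 / 2 - δ) k := by
    intro k hk hk1 hk2
    have hk' : k ≤ m := by simpa [Nat.lt_succ_iff] using hk
    have hk1R : (m : ℝ) ≤ 2 * k := by exact_mod_cast hk1
    unfold bn
    have e : (1 / 2 - δ) ^ k * (1 - (1 / 2 - δ)) ^ (m - k) =
        (1 / 2) ^ m * ((1 - 2 * δ) ^ k * (1 + 2 * δ) ^ (m - k)) := by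
      have e3 : (1 / 2 : ℝ) ^ m = (1 / 2) ^ k * (1 / 2) ^ (m - k) := by
        rw [← pow_add]; congr 1; omega
      rw [show (1 / 2 - δ) = 1 / 2 * (1 - 2 * δ) by ring,
        show (1 - 1 / 2 * (1 - 2 * δ)) = 1 / 2 * (1 + 2 * δ) by ring, mul_pow, mul_pow, e3]
      ring
    rw [mul_assoc (m.choose k : ℝ), e]
    have hρle : ρ ≤ (1 - 2 * δ) ^ k * (1 + 2 * δ) ^ (m - k) := by
      have ea : (1 - 2 * δ) ^ k = Real.exp (k * Real.log (1 - 2 * δ)) := by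
        rw [Real.exp_nat_mul, Real.exp_log hp0]
      have eb : (1 + 2 * δ) ^ (m - k) = Real.exp (((m : ℝ) - k) * Real.log (1 + 2 * δ)) := by
        rw [← Nat.cast_sub hk', Real.exp_nat_mul, Real.exp_log hp1]
      rw [ea, eb, ← Real.exp_add, hρ]
      apply Real.exp_le_exp.2
      set a := Real.log (1 - 2 * δ) with ha
      set b := Real.log (1 + 2 * δ) with hb
      have hab : -(4 * δ ^ 2) - (4 * δ ^ 2) ^ 2 ≤ a + b := by
        rw [ha, hb, ← Real.log_mul hp0.ne' hp1.ne',
          show (1 - 2 * δ) * (1 + 2 * δ) = 1 - 4 * δ ^ 2 by ring]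
        exact log_one_sub_ge (by positivity) (by nlinarith)
      have hb1 : b ≤ 2 * δ := by
        have := Real.log_le_sub_one_of_pos hp1
        linarith
      have ha1 : -(2 * δ) - (2 * δ) ^ 2 ≤ a := log_one_sub_ge (by positivity) (by linarith)
      have hd : -(6 * δ) ≤ a - b := by nlinarith
      have hj : (k : ℝ) * a + ((m : ℝ) - k) * b = (m / 2) * (a + b) + ((k : ℝ) - m / 2) * (a - b) := by
        ring
      rw [hj]
      have h10 : (m / 2 : ℝ) * (-(4 * δ ^ 2) - (4 * δ ^ 2) ^ 2) ≤ (m / 2) * (a + b) :=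
        mul_le_mul_of_nonneg_left hab (by positivity)
      have h11 : ((k : ℝ) - m / 2) * (-(6 * δ)) ≤ ((k : ℝ) - m / 2) * (a - b) :=
        mul_le_mul_of_nonneg_left hd (by linarith)
      have h12 : ((k : ℝ) - m / 2) * (6 * δ) ≤ Real.sqrt m * (6 * δ) :=
        mul_le_mul_of_nonneg_right (by linarith) (by positivity)
      nlinarith
    have hc : (0 : ℝ) ≤ m.choose k := by positivity
    have h20 : (m.choose k : ℝ) * ((1 / 2) ^ m * ρ) ≤
        (m.choose k : ℝ) * ((1 / 2) ^ m * ((1 - 2 * δ) ^ k * (1 + 2 * δ) ^ (m - k))) := by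
      gcongr
    linarith
  have hsum : (1 / 2) ^ m * ρ * (∑ k ∈ range (m + 1), if m ≤ 2 * k ∧ (k : ℝ) ≤ m / 2 + Real.sqrt m
      then (m.choose k : ℝ) else 0) ≤ tl m (1 / 2 - δ) ((m + 1) / 2) := by
    unfold tl
    rw [Finset.mul_sum]
    refine Finset.sum_le_sum fun k hk => ?_
    have hb := bn_nonneg (p := 1 / 2 - δ) (by linarith) (by linarith) m k
    by_cases hA : m ≤ 2 * k ∧ (k : ℝ) ≤ m / 2 + Real.sqrt m
    · rw [if_pos hA, if_pos (by omega)]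
      exact hterm k hk hA.1 hA.2
    · rw [if_neg hA, mul_zero]
      split_ifs <;> linarith
  refine le_trans ?_ hsum
  calc ρ / 4 = (1 / 2) ^ m * ρ * (2 ^ m / 4) := by
        linear_combination (-ρ / 4) * e2
    _ ≤ _ := mul_le_mul_of_nonneg_left hw (by positivity)

end Binomial

section Asymptotics
open Finset

/-- `√(log d / d)`. -/
noncomputable def sg (d : ℕ) : ℝ := Real.sqrt (Real.log (d : ℝ) / (d : ℝ))

theorem sg_nonneg (d : ℕ) : 0 ≤ sg d := Real.sqrt_nonneg _

theorem log_pow_div_tendsto (k : ℕ) :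
    Tendsto (fun d : ℕ => Real.log (d : ℝ) ^ k / (d : ℝ)) atTop (nhds 0) := by
  have h := Real.tendsto_pow_log_div_mul_add_atTop 1 0 k one_ne_zero
  have h2 := h.comp tendsto_natCast_atTop_atTop
  refine h2.congr fun d => ?_
  simp

theorem sg_tendsto : Tendsto sg atTop (nhds 0) := by
  have h := log_pow_div_tendsto 1
  have h2 := (Real.continuous_sqrt.tendsto 0).comp h
  rw [Real.sqrt_zero] at h2
  refine h2.congr fun d => ?_
  simp [sg]

theorem mul_sg_lt_ev (c : ℝ) {η : ℝ} (hη : 0 < η) : ∀ᶠ d : ℕ in atTop, c * sg d < η := by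
  have h := sg_tendsto.const_mul c
  rw [mul_zero] at h
  exact h.eventually (gt_mem_nhds hη)

theorem ratio_ev (c : ℝ) {T : ℕ} (hT : 1 ≤ T) (C0 C : ℕ) : ∀ᶠ d : ℕ in atTop, ∀ m : ℕ,
    d ≤ m + C0 → C + 2 * T ≤ m ∧
    (1 - 1 / (2 * T) : ℝ) * (((m : ℝ) / 2 + C + T + 1) * (1 - (1 / 2 - c * sg d))) ≤
      ((m : ℝ) / 2 - C - T) * (1 / 2 - c * sg d) := by
  have hT' : (1 : ℝ) ≤ T := by exact_mod_cast hT
  have hη : (0 : ℝ) < 1 / (2 * T) := by positivity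
  have hη1 : (1 : ℝ) / (2 * T) ≤ 1 / 2 := by
    rw [div_le_div_iff₀ (by positivity) (by norm_num)]; linarith
  set η : ℝ := 1 / (2 * T) with hηdef
  obtain ⟨N, hN⟩ := exists_nat_ge (8 * ((C : ℝ) + T + 1) / η)
  filter_upwards [mul_sg_lt_ev c (show 0 < η / 8 by positivity),
    mul_sg_lt_ev (-c) (show 0 < η / 8 by positivity),
    eventually_ge_atTop (N + C0 + C + 2 * T)] with d h1 h2 h3 m hm
  refine ⟨by omega, ?_⟩
  have hmN : (N : ℝ) ≤ m := by exact_mod_cast (by omega : N ≤ m)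
  have h4 : 8 * ((C : ℝ) + T + 1) ≤ m * η := by
    rw [div_le_iff₀ hη] at hN
    nlinarith
  set δ := c * sg d with hδ
  have hδ2 : -(η / 8) < δ := by
    have : -c * sg d = - δ := by rw [hδ]; ring
    linarith
  set B : ℝ := (C : ℝ) + T + 1 with hB
  have hB0 : 0 ≤ B := by positivity
  have hm0 : (0 : ℝ) ≤ m := by positivity
  have e1 : (m : ℝ) / 2 + C + T + 1 = m / 2 + B := by rw [hB]; ring
  have e2 : (m : ℝ) / 2 - C - T = m / 2 - B + 1 := by rw [hB]; ring
  rw [e1, e2]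
  have k1 : (1 - η) * (1 / 2 + δ) ≤ 1 / 2 - δ - η / 4 := by nlinarith
  have k2 : (1 - η) * ((m / 2 + B) * (1 - (1 / 2 - δ))) ≤ (m / 2 + B) * (1 / 2 - δ - η / 4) := by
    have := mul_le_mul_of_nonneg_left k1 (show (0 : ℝ) ≤ m / 2 + B by positivity)
    linarith
  have k3 : B * (1 / 2 - δ) ≤ B * 1 := mul_le_mul_of_nonneg_left (by linarith) hB0
  nlinarith

theorem sqrt_log_tendsto : Tendsto (fun d : ℕ => Real.sqrt (Real.log (d : ℝ))) atTop atTop :=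
  Real.tendsto_sqrt_atTop.comp (Real.tendsto_log_atTop.comp tendsto_natCast_atTop_atTop)

theorem exp_beats {a : ℝ} (ha : 0 < a) (b B : ℝ) :
    ∀ᶠ s : ℝ in atTop, B * s ≤ Real.exp (a * s ^ 2 - b * s - 10) := by
  filter_upwards [eventually_ge_atTop 1, eventually_ge_atTop ((b + 11) / a),
    eventually_ge_atTop (2 * B)] with s h1 h2 h3
  have h4 : s ≤ a * s ^ 2 - b * s - 10 := by
    rw [div_le_iff₀ ha] at h2
    nlinarith
  refine le_trans ?_ (Real.exp_le_exp.2 h4)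
  have := Real.quadratic_le_exp_of_nonneg (x := s) (by linarith)
  nlinarith

set_option maxHeartbeats 2000000 in
theorem tail_ev {c : ℝ} (hc0 : 0 < c) (hc : c < 1 / 2) (C0 C1 : ℕ) (Cb : ℝ) :
    ∀ᶠ d : ℕ in atTop, ∀ m : ℕ, d ≤ m + C0 → m ≤ d + C0 → ∀ t : ℕ, 2 * t ≤ m + C1 →
      Cb * sg d ≤ tl m (1 / 2 - c * sg d) t := by
  have ha : 0 < 1 / 2 - 2 * c ^ 2 := by nlinarith
  have l1 := log_pow_div_tendsto 1
  have l2 := log_pow_div_tendsto 2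
  have l1' : ∀ᶠ d : ℕ in atTop, (C0 : ℝ) * (Real.log (d : ℝ) ^ 1 / d) < 1 := by
    have := l1.const_mul (C0 : ℝ)
    rw [mul_zero] at this
    exact this.eventually (gt_mem_nhds one_pos)
  have l2' : ∀ᶠ d : ℕ in atTop, Real.log (d : ℝ) ^ 2 / d < 1 :=
    l2.eventually (gt_mem_nhds one_pos)
  filter_upwards [ratio_ev c (T := 2) (by norm_num) C0 (2 * C1 + 2), l1', l2',
    mul_sg_lt_ev c (show (0 : ℝ) < 1 / 8 by norm_num), eventually_ge_atTop (C0 + 3),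
    sqrt_log_tendsto.eventually (exp_beats ha (12 * c) (4 * 2 ^ C1 * |Cb|))]
    with d hr hl1 hl2 hδ hd hexp m hm1 hm2 t ht
  obtain ⟨hr1, hr2⟩ := hr m hm1
  set δ := c * sg d with hδdef
  have hδ0 : 0 ≤ δ := mul_nonneg hc0.le (sg_nonneg d)
  have h0 : 0 ≤ 1 / 2 - δ := by linarith
  have h1 : 1 / 2 - δ < 1 := by linarith
  have hdR : (0 : ℝ) < d := by
    have : 0 < d := by omega
    exact_mod_cast this
  -- iterate the ratio bound
  have hit : ∀ i, i ≤ C1 → tl m (1 / 2 - δ) ((m + 1) / 2) ≤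
      2 ^ i * tl m (1 / 2 - δ) ((m + 1) / 2 + i) := by
    intro i
    induction i with
    | zero => simp
    | succ i ih =>
      intro hi
      have h2 := ih (by omega)
      have h3 := tl_ratio' h0 h1 (by norm_num) hr1 hr2 (k := (m + 1) / 2 + i) (by omega)
      have h4 : (1 + 2 / ((2 : ℕ) : ℝ)) = 2 := by norm_num
      rw [h4] at h3
      refine h2.trans ?_
      rw [pow_succ, mul_assoc]
      exact mul_le_mul_of_nonneg_left h3 (by positivity)
  have h2 := hit C1 le_rfl
  have h3 : tl m (1 / 2 - δ) ((m + 1) / 2 + C1) ≤ tl m (1 / 2 - δ) t :=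
    tl_anti h0 h1.le m (by omega)
  have h4 := tl_lower (m := m) (by omega) hδ0 hδ.le
  set L := Real.log (d : ℝ) with hL
  have hLpos : 0 < L := Real.log_pos (by
    have : 1 < d := by omega
    exact_mod_cast this)
  have hsg2 : sg d ^ 2 = L / d := by
    unfold sg; rw [Real.sq_sqrt (by positivity)]
  have hmd : (m : ℝ) ≤ d + C0 := by exact_mod_cast hm2
  have hmd2 : (m : ℝ) ≤ 2 * d := by exact_mod_cast (by omega : m ≤ 2 * d)
  have hc2 : c ^ 2 ≤ 1 / 4 := by nlinarith
  have b1 : m * δ ^ 2 ≤ c ^ 2 * L + 1 := by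
    have : m * δ ^ 2 = c ^ 2 * (m * (L / d)) := by rw [hδdef, mul_pow, hsg2]; ring
    rw [this]
    have h5 : m * (L / d) ≤ L + C0 * (L ^ 1 / d) := by
      have : (m : ℝ) * (L / d) ≤ (d + C0) * (L / d) :=
        mul_le_mul_of_nonneg_right hmd (by positivity)
      refine this.trans (le_of_eq ?_)
      field_simp
    have h6 : m * (L / d) ≤ L + 1 := by linarith
    nlinarith [sq_nonneg c]
  have b2 : m * δ ^ 4 ≤ 1 := by
    have : m * δ ^ 4 = c ^ 4 * (m * (L / d) ^ 2) := by
      rw [hδdef, mul_pow, ← hsg2]; ring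
    rw [this]
    have h5 : m * (L / d) ^ 2 ≤ 2 := by
      have h6 : (m : ℝ) * (L / d) ^ 2 ≤ (2 * d) * (L / d) ^ 2 :=
        mul_le_mul_of_nonneg_right hmd2 (by positivity)
      refine h6.trans ?_
      have h7 : (2 * d : ℝ) * (L / d) ^ 2 = 2 * (L ^ 2 / d) := by field_simp
      rw [h7]; linarith
    have h8 : c ^ 4 ≤ 1 / 4 := by nlinarith [sq_nonneg c]
    have h9 : (0 : ℝ) ≤ m * (L / d) ^ 2 := by positivity
    nlinarith [pow_nonneg hc0.le 4]
  have b3 : δ * Real.sqrt m ≤ 2 * c * Real.sqrt L := by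
    have h5 : sg d * Real.sqrt m ≤ 2 * Real.sqrt L := by
      unfold sg
      rw [← Real.sqrt_mul (by positivity)]
      have h6 : (2 : ℝ) * Real.sqrt L = Real.sqrt (4 * L) := by
        rw [Real.sqrt_mul (by norm_num), show (4 : ℝ) = 2 ^ 2 by norm_num,
          Real.sqrt_sq (by norm_num)]
      rw [h6]
      apply Real.sqrt_le_sqrt
      rw [div_mul_eq_mul_div, div_le_iff₀ hdR]
      nlinarith
    rw [hδdef]
    nlinarith
  have h5 : Real.exp (-(2 * c ^ 2 * L + 10 + 12 * c * Real.sqrt L)) / 4 ≤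
      2 ^ C1 * tl m (1 / 2 - δ) t := by
    have h6 : Real.exp (-(2 * c ^ 2 * L + 10 + 12 * c * Real.sqrt L)) ≤
        Real.exp (-(2 * m * δ ^ 2 + 8 * m * δ ^ 4 + 6 * δ * Real.sqrt m)) := by
      apply Real.exp_le_exp.2
      nlinarith
    have h7 : (2 : ℝ) ^ C1 * tl m (1 / 2 - δ) ((m + 1) / 2 + C1) ≤ 2 ^ C1 * tl m (1 / 2 - δ) t :=
      mul_le_mul_of_nonneg_left h3 (by positivity)
    linarith
  have hsgd : sg d = Real.sqrt L * Real.exp (-(L / 2)) := by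
    unfold sg
    rw [Real.sqrt_div' _ hdR.le]
    have : Real.sqrt d = Real.exp (L / 2) := by
      rw [Real.exp_half, hL, Real.exp_log hdR]
    rw [this, Real.exp_neg]
    rfl
  have hsq : Real.sqrt L ^ 2 = L := Real.sq_sqrt hLpos.le
  have h8 : 4 * 2 ^ C1 * |Cb| * sg d ≤
      Real.exp (-(2 * c ^ 2 * L + 10 + 12 * c * Real.sqrt L)) := by
    rw [hsgd]
    calc 4 * 2 ^ C1 * |Cb| * (Real.sqrt L * Real.exp (-(L / 2)))
        = (4 * 2 ^ C1 * |Cb| * Real.sqrt L) * Real.exp (-(L / 2)) := by ring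
      _ ≤ Real.exp ((1 / 2 - 2 * c ^ 2) * Real.sqrt L ^ 2 - 12 * c * Real.sqrt L - 10) *
          Real.exp (-(L / 2)) := mul_le_mul_of_nonneg_right hexp (Real.exp_pos _).le
      _ = _ := by
        rw [← Real.exp_add]; congr 1; rw [hsq]; ring
  have h9 : (2 : ℝ) ^ C1 * (Cb * sg d) ≤ 2 ^ C1 * tl m (1 / 2 - δ) t := by
    have : Cb * sg d ≤ |Cb| * sg d := mul_le_mul_of_nonneg_right (le_abs_self _) (sg_nonneg d)
    have h10 : (2 : ℝ) ^ C1 * (Cb * sg d) ≤ 2 ^ C1 * (|Cb| * sg d) :=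
      mul_le_mul_of_nonneg_left this (by positivity)
    linarith
  exact le_of_mul_le_mul_left h9 (by positivity)

end Asymptotics

section SecondMoment
set_option linter.unusedSectionVars false
open Finset

open Classical in
/-- Real-valued indicator of a proposition. -/
noncomputable def ind (P : Prop) : ℝ := if P then 1 else 0

theorem ind_pos {P : Prop} (h : P) : ind P = 1 := by simp [ind, h]

theorem ind_neg {P : Prop} (h : ¬ P) : ind P = 0 := by simp [ind, h]

theorem ind_nonneg (P : Prop) : 0 ≤ ind P := by
  by_cases h : P
  · rw [ind_pos h]; norm_num
  · rw [ind_neg h]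

theorem ind_mono {P Q : Prop} (h : P → Q) : ind P ≤ ind Q := by
  by_cases hP : P
  · rw [ind_pos hP, ind_pos (h hP)]
  · rw [ind_neg hP]; exact ind_nonneg Q

theorem ind_and (P Q : Prop) : ind (P ∧ Q) = ind P * ind Q := by
  by_cases hP : P <;> by_cases hQ : Q <;> simp [ind, hP, hQ]

theorem ind_or_le {P Q R : Prop} (h : P → Q ∨ R) : ind P ≤ ind Q + ind R := by
  by_cases hP : P
  · rcases h hP with h | h
    · rw [ind_pos hP, ind_pos h]; linarith [ind_nonneg R]
    · rw [ind_pos hP, ind_pos h]; linarith [ind_nonneg Q]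
  · rw [ind_neg hP]; linarith [ind_nonneg R, ind_nonneg Q]

theorem ind_le_sq {P : Prop} {a r : ℝ} (hr : 0 < r) (h : P → r ≤ |a|) :
    ind P ≤ (1 / r ^ 2) * a ^ 2 := by
  by_cases hP : P
  · rw [ind_pos hP, div_mul_eq_mul_div, le_div_iff₀ (by positivity), one_mul, one_mul,
      ← sq_abs a]
    exact pow_le_pow_left₀ hr.le (h hP) 2
  · rw [ind_neg hP]; positivity

variable {V : Type} [Fintype V] [DecidableEq V]

theorem prob_eq' (p : ℝ) (E : Set V → Prop) :
    prob p E = Ex p univ (fun A : Finset V => ind (E (↑A : Set V))) := by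
  classical
  rw [prob_eq]
  rfl

theorem Ex_tail (p : ℝ) (S : Finset V) (t : ℕ) :
    Ex p univ (fun A => ind (t ≤ #(S ∩ A))) = tl (#S) p t := by
  rw [Ex_card p S (fun k => ind (t ≤ k))]
  unfold tl
  refine Finset.sum_congr rfl fun k _ => ?_
  by_cases h : t ≤ k <;> simp [ind, h]

theorem Loc_ind_card (S : Finset V) (t : ℕ) : Loc S (fun A => ind (t ≤ #(S ∩ A))) := by
  intro A
  have : S ∩ (A ∩ S) = S ∩ A := by ext a; simp only [mem_inter]; tauto
  simp only [this]

theorem Loc_ind_not_mem (z : V) : Loc ({z} : Finset V) (fun A => ind (z ∉ A)) := by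
  intro A
  have : z ∉ A ∩ {z} ↔ z ∉ A := by simp
  simp only [this]

/-- The vertex `z` is not in `A`, but at least `t` elements of `S` are. -/
noncomputable def Xi (z : V) (S : Finset V) (t : ℕ) (A : Finset V) : ℝ :=
  ind (z ∉ A) * ind (t ≤ #(S ∩ A))

theorem Xi_loc (z : V) (S : Finset V) (t : ℕ) : Loc (insert z S) (Xi z S t) := by
  intro A
  unfold Xi
  have h1 := (Loc_ind_not_mem z).mono (T := insert z S) (by simp) A
  have h2 := (Loc_ind_card S t).mono (T := insert z S) (by simp) A
  rw [h1, h2]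

theorem Ex_not_mem (p : ℝ) (z : V) : Ex p univ (fun A => ind (z ∉ A)) = 1 - p := by
  have h := Ex_card p ({z} : Finset V) (fun k => ind (k = 0))
  have e : (fun A : Finset V => ind (z ∉ A)) = fun A => ind (#(({z} : Finset V) ∩ A) = 0) := by
    funext A
    congr 1
    by_cases hz : z ∈ A <;> simp [hz]
  rw [e, h]
  simp [bn, ind]

theorem Xi_Ex (p : ℝ) {z : V} {S : Finset V} (hz : z ∉ S) (t : ℕ) :
    Ex p univ (Xi z S t) = (1 - p) * tl (#S) p t := by
  unfold Xi
  rw [Ex_indep p (Loc_ind_not_mem z) (Loc_ind_card S t) (by simpa using hz), Ex_tail, Ex_not_mem]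

theorem Xi_nonneg (z : V) (S : Finset V) (t : ℕ) (A : Finset V) : 0 ≤ Xi z S t A :=
  mul_nonneg (ind_nonneg _) (ind_nonneg _)

theorem Xi_sq (z : V) (S : Finset V) (t : ℕ) (A : Finset V) :
    Xi z S t A * Xi z S t A = Xi z S t A := by
  unfold Xi ind
  split_ifs <;> simp

theorem second_moment {p ε : ℝ} (h0 : 0 ≤ p) (h1 : p < 1) (hε : 0 ≤ ε) (Z : Finset V)
    (F : V → Finset V) (t : V → ℕ)
    (hF1 : ∀ z ∈ Z, ∀ z' ∈ Z, z ∉ F z')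
    (hF2 : ∀ z ∈ Z, ∀ z' ∈ Z, z ≠ z' → #(F z ∩ F z') ≤ 1)
    (hr : ∀ z ∈ Z, ∀ m, m ≤ #(F z) → #(F z) ≤ m + 1 →
      tl m p (t z - 1) ≤ (1 + ε) * tl m p (t z))
    {μ : ℝ} (hμ : μ = ∑ z ∈ Z, (1 - p) * tl (#(F z)) p (t z)) (hμ0 : 0 < μ) :
    Ex p univ (fun A => ind (∑ z ∈ Z, Xi z (F z) (t z) A < μ / 2)) ≤
      4 / μ + 4 * ((1 + ε) ^ 2 - 1) := by
  have hEX : ∀ z ∈ Z, Ex p univ (Xi z (F z) (t z)) = (1 - p) * tl (#(F z)) p (t z) :=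
    fun z hz => Xi_Ex p (hF1 z hz z hz) (t z)
  set μz : V → ℝ := fun z => (1 - p) * tl (#(F z)) p (t z) with hμz
  have hμz0 : ∀ z, 0 ≤ μz z := fun z =>
    mul_nonneg (by linarith) (tl_nonneg h0 h1.le _ _)
  have hminus : ∀ z ∈ Z, ∀ z' ∈ Z, z ≠ z' →
      Ex p univ (Xi z (F z \ F z') (t z - 1)) ≤ (1 + ε) * μz z := by
    intro z hz z' hz' hne
    have hzS : z ∉ F z \ F z' := fun h => hF1 z hz z hz (Finset.mem_sdiff.1 h).1
    rw [Xi_Ex p hzS]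
    have hc := hF2 z hz z' hz' hne
    have hc2 := Finset.card_sdiff_add_card_inter (F z) (F z')
    have h3 := hr z hz (#(F z \ F z')) (by omega) (by omega)
    have h4 : (1 - p) * tl (#(F z \ F z')) p (t z) ≤ μz z := by
      show _ ≤ (1 - p) * tl (#(F z)) p (t z)
      rw [← Xi_Ex p hzS, ← hEX z hz]
      refine Ex_mono h0 h1.le _ fun A => ?_
      unfold Xi
      refine mul_le_mul_of_nonneg_left (ind_mono fun h => h.trans ?_) (ind_nonneg _)
      exact Finset.card_le_card (Finset.inter_subset_inter_right Finset.sdiff_subset)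
    have h5 : (1 - p) * tl (#(F z \ F z')) p (t z - 1) ≤
        (1 - p) * ((1 + ε) * tl (#(F z \ F z')) p (t z)) :=
      mul_le_mul_of_nonneg_left h3 (by linarith)
    nlinarith
  have hpair : ∀ z ∈ Z, ∀ z' ∈ Z, Ex p univ (fun A => Xi z (F z) (t z) A * Xi z' (F z') (t z') A) ≤
      (if z = z' then μz z else 0) + (1 + ε) ^ 2 * (μz z * μz z') := by
    intro z hz z' hz'
    by_cases hne : z = z'
    · subst hne
      simp only [Xi_sq, if_true]
      rw [hEX z hz]
      have := mul_nonneg (hμz0 z) (hμz0 z)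
      have : 0 ≤ (1 + ε) ^ 2 * (μz z * μz z) := by positivity
      linarith
    · rw [if_neg hne, zero_add]
      have hstep : ∀ a ∈ Z, ∀ b ∈ Z, a ≠ b → ∀ A, Xi a (F a) (t a) A ≤
          Xi a (F a \ F b) (t a - 1) A := by
        intro a ha b hb hab A
        unfold Xi
        refine mul_le_mul_of_nonneg_left (ind_mono fun h => ?_) (ind_nonneg _)
        have hsub : F a ∩ A ⊆ ((F a \ F b) ∩ A) ∪ (F a ∩ F b) := by
          intro w hw
          simp only [mem_inter, mem_union, Finset.mem_sdiff] at *
          tauto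
        have h6 := Finset.card_le_card hsub
        have h7 := Finset.card_union_le ((F a \ F b) ∩ A) (F a ∩ F b)
        have h8 := hF2 a ha b hb hab
        omega
      have h9 : Ex p univ (fun A => Xi z (F z) (t z) A * Xi z' (F z') (t z') A) ≤
          Ex p univ (fun A => Xi z (F z \ F z') (t z - 1) A * Xi z' (F z' \ F z) (t z' - 1) A) := by
        refine Ex_mono h0 h1.le _ fun A => ?_
        exact mul_le_mul (hstep z hz z' hz' hne A) (hstep z' hz' z hz (Ne.symm hne) A)
          (Xi_nonneg _ _ _ _) (Xi_nonneg _ _ _ _)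
      refine h9.trans ?_
      rw [Ex_indep p (Xi_loc _ _ _) (Xi_loc _ _ _)]
      · have ha := hminus z hz z' hz' hne
        have hb := hminus z' hz' z hz (Ne.symm hne)
        have hb0 : 0 ≤ Ex p univ (Xi z' (F z' \ F z) (t z' - 1)) :=
          Ex_nonneg h0 h1.le _ (Xi_nonneg _ _ _)
        calc _ ≤ ((1 + ε) * μz z) * ((1 + ε) * μz z') :=
              mul_le_mul ha hb hb0 (mul_nonneg (by linarith) (hμz0 z))
          _ = _ := by ring
      · rw [Finset.disjoint_left]
        intro a ha hb
        simp only [mem_insert, Finset.mem_sdiff] at ha hb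
        rcases ha with rfl | ha
        · rcases hb with hb | hb
          · exact hne hb
          · exact hF1 a hz z' hz' hb.1
        · rcases hb with rfl | hb
          · exact hF1 a hz' z hz ha.1
          · exact ha.2 hb.1
  set Y : Finset V → ℝ := fun A => ∑ z ∈ Z, Xi z (F z) (t z) A with hY
  have hEY : Ex p univ Y = μ := by
    rw [hY, Ex_sum, hμ]
    exact Finset.sum_congr rfl hEX
  have hμs : ∑ z ∈ Z, μz z = μ := hμ.symm
  have hEY2 : Ex p univ (fun A => Y A * Y A) ≤ μ + (1 + ε) ^ 2 * μ ^ 2 := by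
    have e : (fun A => Y A * Y A) =
        fun A => ∑ z ∈ Z, ∑ z' ∈ Z, Xi z (F z) (t z) A * Xi z' (F z') (t z') A := by
      funext A
      rw [hY, Finset.sum_mul_sum]
    rw [e, Ex_sum]
    simp_rw [Ex_sum]
    calc _ ≤ ∑ z ∈ Z, ∑ z' ∈ Z, ((if z = z' then μz z else 0) + (1 + ε) ^ 2 * (μz z * μz z')) :=
          Finset.sum_le_sum fun z hz => Finset.sum_le_sum fun z' hz' => hpair z hz z' hz'
      _ = _ := by
        simp_rw [Finset.sum_add_distrib, ← Finset.mul_sum]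
        rw [← Finset.sum_mul, hμs, sq μ]
        congr 1
        rw [← hμs]
        refine Finset.sum_congr rfl fun z hz => ?_
        rw [Finset.sum_ite_eq, if_pos hz]
  have hvar : Ex p univ (fun A => (Y A - μ) ^ 2) ≤ μ + ((1 + ε) ^ 2 - 1) * μ ^ 2 := by
    have e : (fun A => (Y A - μ) ^ 2) =
        fun A => (Y A * Y A + (-2 * μ) * Y A) + μ ^ 2 := by
      funext A; ring
    rw [e, Ex_add, Ex_add, Ex_mul, Ex_const, hEY]
    linarith
  calc _ ≤ Ex p univ (fun A => (1 / (μ / 2) ^ 2) * (Y A - μ) ^ 2) := by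
        refine Ex_mono h0 h1.le _ fun A => ?_
        refine ind_le_sq (by linarith) fun h => ?_
        rw [abs_of_neg (by linarith)]
        linarith
    _ = (1 / (μ / 2) ^ 2) * Ex p univ (fun A => (Y A - μ) ^ 2) := Ex_mul _ _ _ _
    _ ≤ (1 / (μ / 2) ^ 2) * (μ + ((1 + ε) ^ 2 - 1) * μ ^ 2) :=
        mul_le_mul_of_nonneg_left hvar (by positivity)
    _ = _ := by field_simp; ring

theorem chebyshev {p M : ℝ} (h0 : 0 ≤ p) (h1 : p ≤ 1) (hM : 0 < M) (S : Finset V)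
    (hS : 1 ≤ #S) :
    Ex p univ (fun A => ind ((#(S ∩ A) : ℝ) < p * #S - M * Real.sqrt (#S))) ≤ 1 / (4 * M ^ 2) := by
  have hS' : (1 : ℝ) ≤ #S := by exact_mod_cast hS
  have hs : 0 < Real.sqrt (#S) := Real.sqrt_pos.2 (by linarith)
  have hsq : Real.sqrt (#S) ^ 2 = #S := Real.sq_sqrt (by linarith)
  calc _ ≤ Ex p univ (fun A => (1 / (M * Real.sqrt (#S)) ^ 2) * ((#(S ∩ A) : ℝ) - #S * p) ^ 2) := by
        refine Ex_mono h0 h1 _ fun A => ?_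
        refine ind_le_sq (by positivity) fun h => ?_
        have : 0 < M * Real.sqrt (#S) := by positivity
        rw [abs_of_neg (by linarith)]
        linarith
    _ = (1 / (M * Real.sqrt (#S)) ^ 2) * (#S * p * (1 - p)) := by
        rw [Ex_mul, Ex_card p S (fun k => ((k : ℝ) - #S * p) ^ 2), bn_var]
    _ ≤ (1 / (M * Real.sqrt (#S)) ^ 2) * (#S / 4) := by
        refine mul_le_mul_of_nonneg_left ?_ (by positivity)
        nlinarith [sq_nonneg (p - 1 / 2)]
    _ = _ := by
        rw [mul_pow, hsq]; field_simp

end SecondMoment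

section Local
open Finset

/-- Neighbourhood as a finset. -/
noncomputable def nb {V : Type} [Finite V] (G : SimpleGraph V) (v : V) : Finset V :=
  (Set.toFinite (G.neighborSet v)).toFinset

theorem mem_nb {V : Type} [Finite V] {G : SimpleGraph V} {v w : V} : w ∈ nb G v ↔ G.Adj v w := by
  simp [nb]

theorem coe_nb {V : Type} [Finite V] (G : SimpleGraph V) (v : V) :
    (↑(nb G v) : Set V) = G.neighborSet v := by
  simp [nb]

theorem card_nb {V : Type} [Finite V] (G : SimpleGraph V) (v : V) : #(nb G v) = deg G v := by
  rw [deg, ← coe_nb, Set.ncard_coe_finset]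

theorem adj_sphere {V : Type} {G : SimpleGraph V} {v w : V} (h : G.Adj v w) : w ∈ sphere G v 1 := by
  show G.edist v w = ((1 : ℕ) : ℕ∞)
  rw [Nat.cast_one]
  exact SimpleGraph.edist_eq_one_iff_adj.2 h

theorem edist_adj_le {V : Type} {G : SimpleGraph V} {x v w : V} {n : ℕ} (h : G.Adj v w)
    (hv : G.edist x v ≤ n) : G.edist x w ≤ (n + 1 : ℕ) := by
  refine le_trans (SimpleGraph.edist_triangle (v := v)) ?_
  rw [SimpleGraph.edist_eq_one_iff_adj.2 h, Nat.cast_add, Nat.cast_one]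
  gcongr

theorem card_le_ncard {V : Type} [Finite V] {S : Finset V} {T : Set V} (h : (↑S : Set V) ⊆ T) :
    #S ≤ T.ncard := by
  rw [← Set.ncard_coe_finset]
  exact Set.ncard_le_ncard h (Set.toFinite _)

theorem local_det {V : Type} [Fintype V] [DecidableEq V] {G : SimpleGraph V} {y : V}
    {p M : ℝ} {Z : Finset V} {F : V → Finset V} {t : V → ℕ} {A : Finset V} {μ : ℝ}
    (hZ : Z ⊆ nb G y) (hF : ∀ z ∈ Z, F z ⊆ nb G z) (ht : ∀ z ∈ Z, deg G z ≤ 2 * t z)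
    (hR : (1 / 2 - p) * deg G y + M * Real.sqrt (deg G y) ≤ μ / 2)
    (hA : y ∉ bootIter G (↑A : Set V) 2) :
    ((#(nb G y ∩ A) : ℝ) < p * #(nb G y) - M * Real.sqrt (#(nb G y))) ∨
      (∑ z ∈ Z, Xi z (F z) (t z) A < μ / 2) := by
  classical
  by_contra hcon
  push Not at hcon
  obtain ⟨h1, h2⟩ := hcon
  apply hA
  show y ∈ bootStep G (bootIter G (↑A : Set V) 1)
  refine Or.inr ?_
  show (deg G y : ℝ) / 2 ≤ ((G.neighborSet y ∩ bootIter G (↑A : Set V) 1).ncard : ℝ)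
  set W := Z.filter (fun z => z ∉ A ∧ t z ≤ #(F z ∩ A)) with hW
  have hsum : ∑ z ∈ Z, Xi z (F z) (t z) A = #W := by
    rw [hW, Finset.card_filter]
    push_cast
    refine Finset.sum_congr rfl fun z _ => ?_
    unfold Xi
    rw [← ind_and]
    by_cases h : z ∉ A ∧ t z ≤ #(F z ∩ A)
    · rw [ind_pos h, if_pos h]
    · rw [ind_neg h, if_neg h]
  have hdisj : Disjoint (nb G y ∩ A) W := by
    rw [Finset.disjoint_left]
    intro a ha hb
    exact (Finset.mem_filter.1 hb).2.1 (Finset.mem_inter.1 ha).2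
  have hcard := Finset.card_union_of_disjoint hdisj
  have hsub : (↑((nb G y ∩ A) ∪ W) : Set V) ⊆ G.neighborSet y ∩ bootIter G (↑A : Set V) 1 := by
    intro a ha
    rcases Finset.mem_union.1 (Finset.mem_coe.1 ha) with ha | ha
    · have := Finset.mem_inter.1 ha
      exact ⟨mem_nb.1 this.1, Or.inl this.2⟩
    · obtain ⟨haZ, _, hat⟩ := Finset.mem_filter.1 ha
      refine ⟨mem_nb.1 (hZ haZ), Or.inr ?_⟩
      show (deg G a : ℝ) / 2 ≤ ((G.neighborSet a ∩ (↑A : Set V)).ncard : ℝ)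
      have h3 : #(F a ∩ A) ≤ (G.neighborSet a ∩ (↑A : Set V)).ncard := by
        apply card_le_ncard
        intro b hb
        have := Finset.mem_inter.1 (Finset.mem_coe.1 hb)
        exact ⟨mem_nb.1 (hF a haZ this.1), this.2⟩
      have h4 := ht a haZ
      have h5 : deg G a ≤ 2 * (G.neighborSet a ∩ (↑A : Set V)).ncard := by omega
      have h6 : (deg G a : ℝ) ≤ 2 * (G.neighborSet a ∩ (↑A : Set V)).ncard := by exact_mod_cast h5
      linarith
  have h7 := card_le_ncard hsub
  have h8 : ((#(nb G y ∩ A) : ℝ) + #W) ≤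
      ((G.neighborSet y ∩ bootIter G (↑A : Set V) 1).ncard : ℝ) := by
    rw [hcard] at h7
    exact_mod_cast h7
  rw [card_nb] at h1
  rw [hsum] at h2
  linarith

theorem local_struct {V : Type} [Fintype V] [DecidableEq V] {K : ℕ} {G : SimpleGraph V}
    (h1 : P1 K G) (h2 : P2 K G) (h3 : P3 K G) (y : V) :
    ∃ (Z : Finset V) (F : V → Finset V), Z ⊆ nb G y ∧ (∀ z ∈ Z, F z ⊆ nb G z) ∧
      deg G y ≤ #Z + 1 ∧ (∀ z ∈ Z, deg G z ≤ #(F z) + 2 * K) ∧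
      (∀ z ∈ Z, ∀ z' ∈ Z, z ∉ F z') ∧ (∀ z ∈ Z, ∀ z' ∈ Z, z ≠ z' → #(F z ∩ F z') ≤ 1) ∧
      (∀ z ∈ Z, deg G z ≤ deg G y + K ∧ deg G y ≤ deg G z + K) := by
  classical
  obtain ⟨D, hyD, hD⟩ := h3 y
  obtain ⟨d1, d2, d3, -⟩ := hD 1 le_rfl
  refine ⟨(nb G y).filter (fun z => z ∉ D),
    fun z => (nb G z).filter (fun w => w ∈ sphere G y 2 ∧ w ∉ D), Finset.filter_subset _ _,
    fun z _ => Finset.filter_subset _ _, ?_, ?_, ?_, ?_, ?_⟩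
  · rw [← card_nb, ← Finset.card_filter_add_card_filter_not (s := nb G y) (fun z => z ∉ D)]
    gcongr
    refine (card_le_ncard (T := D ∩ sphere G y 1) ?_).trans (by simpa using d1)
    intro a ha
    simp only [Finset.coe_filter, Set.mem_ofPred_eq, not_not] at ha
    exact ⟨ha.2, adj_sphere (mem_nb.1 ha.1)⟩
  · intro z hz
    obtain ⟨hz1, hz2⟩ := Finset.mem_filter.1 hz
    have hzs := adj_sphere (mem_nb.1 hz1)
    have e1 := h2 y 1 le_rfl z hzs
    have e2 := d2 z ⟨hzs, hz2⟩
    rw [← card_nb]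
    have hsub : nb G z ⊆ (nb G z).filter (fun w => w ∈ sphere G y 2 ∧ w ∉ D) ∪
        ((nb G z).filter (fun w => w ∈ ball G y 1) ∪ (nb G z).filter (fun w => w ∈ D)) := by
      intro w hw
      simp only [Finset.mem_union, Finset.mem_filter, hw, true_and]
      by_cases hwD : w ∈ D
      · exact Or.inr (Or.inr hwD)
      by_cases hwb : w ∈ ball G y 1
      · exact Or.inr (Or.inl hwb)
      refine Or.inl ⟨?_, hwD⟩
      have : G.edist y w ≤ (1 + 1 : ℕ) := edist_adj_le (mem_nb.1 hw) (le_of_eq hzs)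
      refine le_antisymm this ?_
      have hlt : ((1 : ℕ) : ℕ∞) < G.edist y w := not_le.1 hwb
      have := Order.add_one_le_of_lt hlt
      exact_mod_cast this
    have c1 := Finset.card_le_card hsub
    have c2 := Finset.card_union_le ((nb G z).filter (fun w => w ∈ sphere G y 2 ∧ w ∉ D))
      ((nb G z).filter (fun w => w ∈ ball G y 1) ∪ (nb G z).filter (fun w => w ∈ D))
    have c3 := Finset.card_union_le ((nb G z).filter (fun w => w ∈ ball G y 1))
      ((nb G z).filter (fun w => w ∈ D))
    have c4 : #((nb G z).filter (fun w => w ∈ ball G y 1)) ≤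
        (G.neighborSet z ∩ ball G y 1).ncard := by
      apply card_le_ncard
      intro w hw
      obtain ⟨hw1, hw2⟩ := Finset.mem_filter.1 (Finset.mem_coe.1 hw)
      exact ⟨mem_nb.1 hw1, hw2⟩
    have c5 : #((nb G z).filter (fun w => w ∈ D)) ≤ (D ∩ G.neighborSet z).ncard := by
      apply card_le_ncard
      intro w hw
      obtain ⟨hw1, hw2⟩ := Finset.mem_filter.1 (Finset.mem_coe.1 hw)
      exact ⟨hw2, mem_nb.1 hw1⟩
    beta_reduce
    omega
  · intro z hz z' hz' hmem
    have e1 : G.edist y z = ((1 : ℕ) : ℕ∞) := adj_sphere (mem_nb.1 (Finset.mem_filter.1 hz).1)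
    have e2 : G.edist y z = ((2 : ℕ) : ℕ∞) := (Finset.mem_filter.1 hmem).2.1
    rw [e1] at e2
    have : (1 : ℕ) = 2 := by exact_mod_cast e2
    omega
  · intro z hz z' hz' hne
    obtain ⟨hz1, hz2⟩ := Finset.mem_filter.1 hz
    obtain ⟨hz1', hz2'⟩ := Finset.mem_filter.1 hz'
    refine (card_le_ncard ?_).trans
      (d3 z ⟨adj_sphere (mem_nb.1 hz1), hz2⟩ z' ⟨adj_sphere (mem_nb.1 hz1'), hz2'⟩ hne)
    intro w hw
    obtain ⟨hw1, hw2⟩ := Finset.mem_inter.1 (Finset.mem_coe.1 hw)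
    obtain ⟨a1, a2, a3⟩ := Finset.mem_filter.1 hw1
    obtain ⟨b1, -, -⟩ := Finset.mem_filter.1 hw2
    exact ⟨⟨mem_nb.1 a1, mem_nb.1 b1⟩, a2, a3⟩
  · intro z hz
    obtain ⟨hz1, hz2⟩ := Finset.mem_filter.1 hz
    have := h1 y 1 le_rfl z (adj_sphere (mem_nb.1 hz1))
    rw [abs_le] at this
    push_cast at this
    omega

theorem d_sg_ge : ∀ᶠ d : ℕ in atTop, Real.sqrt d ≤ d * sg d := by
  have h := (Real.tendsto_log_atTop.comp (tendsto_natCast_atTop_atTop (R := ℝ))).eventually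
    (eventually_ge_atTop (1 : ℝ))
  filter_upwards [h, eventually_ge_atTop 1] with d hd h1
  simp only [Function.comp] at hd
  have hdR : (0 : ℝ) < d := by exact_mod_cast h1
  unfold sg
  rw [Real.sqrt_div' _ hdR.le, mul_div_assoc']
  rw [le_div_iff₀ (Real.sqrt_pos.2 hdR), Real.mul_self_sqrt hdR.le]
  have : 1 ≤ Real.sqrt (Real.log d) := Real.one_le_sqrt.2 hd
  nlinarith

set_option maxHeartbeats 2000000 in
theorem local_bound (K : ℕ) {c : ℝ} (hc0 : 0 < c) (hc : c < 1 / 2) {q : ℝ} (hq : 0 < q) :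
    ∀ᶠ d : ℕ in atTop, ∀ (V : Type) [Fintype V] [DecidableEq V] (G : SimpleGraph V),
      P1 K G → P2 K G → P3 K G → ∀ y : V, d ≤ deg G y + 3 * K → deg G y ≤ d + 3 * K →
      Ex (1 / 2 - c * sg d) univ
        (fun A : Finset V => ind (y ∉ bootIter G (↑A : Set V) 2)) ≤ q := by
  obtain ⟨T, hT⟩ := exists_nat_ge (96 / q + 2)
  obtain ⟨M, hM⟩ := exists_nat_ge (1 / q + 1)
  have hT2 : (2 : ℝ) ≤ T := by
    have : 0 < 96 / q := by positivity
    linarith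
  have hTq : 96 / q ≤ T := by linarith
  have hM1 : (1 : ℝ) ≤ M := by
    have : 0 < 1 / q := by positivity
    linarith
  have hMq : 1 / q ≤ M := by linarith
  set Cb : ℝ := 16 * (c + M) + 64 / q with hCb
  filter_upwards [ratio_ev c (T := T) (by exact_mod_cast (by linarith : (1 : ℝ) ≤ T)) (6 * K + 1) (2 * K + 2),
    tail_ev hc0 hc (6 * K) (2 * K + 1) Cb, d_sg_ge, eventually_ge_atTop (6 * K + 10),
    mul_sg_lt_ev c (show (0 : ℝ) < 1 / 8 by norm_num)] with d hr htl hdsg hd hδ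
    V _ _ G h1 h2 h3 y hy1 hy2
  obtain ⟨Z, F, hZ, hF, hZc, hFc, hF1, hF2, hdeg⟩ := local_struct h1 h2 h3 y
  set δ := c * sg d with hδdef
  have hδ0 : 0 ≤ δ := mul_nonneg hc0.le (sg_nonneg d)
  have hp0 : 0 ≤ 1 / 2 - δ := by linarith
  have hp1 : 1 / 2 - δ < 1 := by linarith
  set t : V → ℕ := fun z => (deg G z + 1) / 2 with ht
  have hFle : ∀ z ∈ Z, #(F z) ≤ deg G z := fun z hz => by
    rw [← card_nb]; exact Finset.card_le_card (hF z hz)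
  set μ : ℝ := ∑ z ∈ Z, (1 - (1 / 2 - δ)) * tl (#(F z)) (1 / 2 - δ) (t z) with hμ
  have hd1 : (1 : ℝ) ≤ Real.sqrt d := Real.one_le_sqrt.2 (by exact_mod_cast (by omega : 1 ≤ d))
  have hX : (1 : ℝ) ≤ d * sg d := hd1.trans hdsg
  have hCbpos : 0 < Cb := by positivity
  have hμge : Cb / 4 * (d * sg d) ≤ μ := by
    have hterm : ∀ z ∈ Z, (1 / 2) * (Cb * sg d) ≤
        (1 - (1 / 2 - δ)) * tl (#(F z)) (1 / 2 - δ) (t z) := by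
      intro z hz
      have a1 := hFc z hz
      have a2 := hdeg z hz
      have a3 := hFle z hz
      have := htl (#(F z)) (by omega) (by omega) (t z) (by simp only [ht]; omega)
      have h5 : 0 ≤ Cb * sg d := mul_nonneg hCbpos.le (sg_nonneg d)
      exact mul_le_mul (by linarith) this h5 (by linarith)
    have h6 := Finset.sum_le_sum hterm
    rw [Finset.sum_const, nsmul_eq_mul] at h6
    refine le_trans ?_ h6
    have h7 : (d : ℝ) / 2 ≤ #Z := by
      have : d ≤ 2 * #Z := by omega
      have : (d : ℝ) ≤ 2 * #Z := by exact_mod_cast this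
      linarith
    have h5 : 0 ≤ Cb * sg d := mul_nonneg hCbpos.le (sg_nonneg d)
    nlinarith
  have hμ0 : 0 < μ := by
    have : 0 < Cb / 4 * (d * sg d) := by positivity
    linarith
  have hn : (deg G y : ℝ) ≤ 2 * d := by exact_mod_cast (by omega : deg G y ≤ 2 * d)
  have hR : (1 / 2 - (1 / 2 - δ)) * deg G y + M * Real.sqrt (deg G y) ≤ μ / 2 := by
    have s1 : Real.sqrt (deg G y) ≤ 2 * (d * sg d) := by
      have : Real.sqrt (deg G y) ≤ Real.sqrt (2 ^ 2 * d) := Real.sqrt_le_sqrt (by linarith)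
      rw [Real.sqrt_mul (by norm_num), Real.sqrt_sq (by norm_num)] at this
      linarith
    have s2 : δ * deg G y ≤ 2 * c * (d * sg d) := by
      have := mul_le_mul_of_nonneg_left hn hδ0
      rw [hδdef] at this ⊢
      linarith
    have s3 : (M : ℝ) * Real.sqrt (deg G y) ≤ M * (2 * (d * sg d)) :=
      mul_le_mul_of_nonneg_left s1 (by positivity)
    have s4 : 16 * (c + M) / 4 * (d * sg d) ≤ Cb / 4 * (d * sg d) := by
      apply mul_le_mul_of_nonneg_right _ (by linarith)
      have : 0 < 64 / q := by positivity
      linarith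
    nlinarith
  have hsm := second_moment (ε := 2 / T) hp0 hp1 (by positivity) Z F t hF1 hF2 (by
    intro z hz m hm1 hm2
    have a1 := hFc z hz
    have a2 := hdeg z hz
    have a3 := hFle z hz
    obtain ⟨r1, r2⟩ := hr m (by omega)
    have htz : 1 ≤ t z := by
      simp only [ht]
      omega
    have := tl_ratio' hp0 hp1 (by exact_mod_cast (by linarith : (1 : ℝ) ≤ T)) r1 r2 (k := t z - 1)
      (by simp only [ht]; omega)
    rwa [Nat.sub_add_cancel htz] at this) hμ hμ0
  have hch := chebyshev (M := (M : ℝ)) hp0 hp1.le (by linarith) (nb G y) (by rw [card_nb]; omega)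
  have hfin : Ex (1 / 2 - δ) univ (fun A : Finset V => ind (y ∉ bootIter G (↑A : Set V) 2)) ≤
      1 / (4 * (M : ℝ) ^ 2) + (4 / μ + 4 * ((1 + 2 / (T : ℝ)) ^ 2 - 1)) := by
    refine le_trans ?_ (add_le_add hch hsm)
    rw [← Ex_add]
    refine Ex_mono hp0 hp1.le _ fun A => ind_or_le fun hA => ?_
    exact local_det hZ hF (fun z _ => by simp only [ht]; omega) hR hA
  refine hfin.trans ?_
  have f1 : 1 / (4 * (M : ℝ) ^ 2) ≤ q / 4 := by
    rw [div_le_div_iff₀ (by positivity) (by norm_num)]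
    rw [div_le_iff₀ hq] at hMq
    nlinarith
  have f2 : 4 / μ ≤ q / 4 := by
    rw [div_le_div_iff₀ hμ0 (by norm_num)]
    have g1 : 64 / q / 4 ≤ μ := by
      refine le_trans ?_ hμge
      have : 64 / q ≤ Cb := by rw [hCb]; have : 0 ≤ 16 * (c + M) := by positivity
                               linarith
      have h9 : 64 / q / 4 ≤ Cb / 4 := by linarith
      exact h9.trans (le_mul_of_one_le_right (by positivity) hX)
    have g2 : q * (64 / q / 4) = 16 := by field_simp; norm_num
    have g3 := mul_le_mul_of_nonneg_left g1 hq.le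
    linarith
  have f3 : 4 * ((1 + 2 / (T : ℝ)) ^ 2 - 1) ≤ q / 4 := by
    have g1 : 2 / (T : ℝ) ≤ 1 := by rw [div_le_one (by linarith)]; exact hT2
    have g2 : 2 / (T : ℝ) ≤ q / 48 := by
      rw [div_le_div_iff₀ (by linarith) (by norm_num)]
      rw [div_le_iff₀ hq] at hTq
      linarith
    have g3 : 0 < 2 / (T : ℝ) := by positivity
    nlinarith
  linarith

end Local

section Global
open Finset

theorem boot_loc {V : Type} (G : SimpleGraph V) (A A' : Set V) (n : ℕ) :
    ∀ y : V, (∀ v ∈ ball G y n, v ∈ A ↔ v ∈ A') →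
      (y ∈ bootIter G A n ↔ y ∈ bootIter G A' n) := by
  induction n with
  | zero =>
    intro y h
    exact h y (by simp [ball])
  | succ n ih =>
    intro y h
    have h0 : y ∈ bootIter G A n ↔ y ∈ bootIter G A' n := by
      apply ih
      intro v hv
      apply h
      exact le_trans (show G.edist y v ≤ n from hv) (by exact_mod_cast Nat.le_succ n)
    have h1 : G.neighborSet y ∩ bootIter G A n = G.neighborSet y ∩ bootIter G A' n := by
      ext v
      simp only [Set.mem_inter_iff, SimpleGraph.mem_neighborSet]
      refine and_congr_right fun hv => ih v fun w hw => h w ?_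
      show G.edist y w ≤ ((n + 1 : ℕ) : ℕ∞)
      refine le_trans (SimpleGraph.edist_triangle (v := v)) ?_
      rw [SimpleGraph.edist_eq_one_iff_adj.2 hv, Nat.cast_add, Nat.cast_one, add_comm]
      gcongr
      exact hw
    show y ∈ bootStep G _ ↔ y ∈ bootStep G _
    unfold bootStep
    simp only [Set.mem_union, Set.mem_ofPred_eq, h0, h1]

/-- Ball as a finset. -/
noncomputable def bl {V : Type} [Finite V] (G : SimpleGraph V) (v : V) (n : ℕ) : Finset V :=
  (Set.toFinite (ball G v n)).toFinset

/-- Sphere as a finset. -/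
noncomputable def sph {V : Type} [Finite V] (G : SimpleGraph V) (v : V) (n : ℕ) : Finset V :=
  (Set.toFinite (sphere G v n)).toFinset

theorem mem_bl {V : Type} [Finite V] {G : SimpleGraph V} {v w : V} {n : ℕ} :
    w ∈ bl G v n ↔ w ∈ ball G v n := by
  simp [bl]

theorem mem_sph {V : Type} [Finite V] {G : SimpleGraph V} {v w : V} {n : ℕ} :
    w ∈ sph G v n ↔ w ∈ sphere G v n := by
  simp [sph]

theorem Loc_boot {V : Type} [Finite V] [DecidableEq V] (G : SimpleGraph V) (y : V) :
    Loc (bl G y 2) (fun A : Finset V => ind (y ∉ bootIter G (↑A : Set V) 2)) := by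
  intro A
  have := boot_loc G (↑A : Set V) (↑(A ∩ bl G y 2) : Set V) 2 y (by
    intro v hv
    simp only [Finset.coe_inter, Set.mem_inter_iff, Finset.mem_coe, mem_bl, hv, and_true])
  simp only [this]

theorem bl_disjoint {V : Type} [Finite V] {G : SimpleGraph V} {y z : V} (h : z ∉ ball G y 5) :
    Disjoint (bl G y 2) (bl G z 2) := by
  rw [Finset.disjoint_left]
  intro v hv hv'
  apply h
  have a : G.edist y v ≤ (2 : ℕ) := mem_bl.1 hv
  have b : G.edist z v ≤ (2 : ℕ) := mem_bl.1 hv'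
  rw [SimpleGraph.edist_comm] at b
  show G.edist y z ≤ (5 : ℕ)
  refine (SimpleGraph.edist_triangle (v := v)).trans ((add_le_add a b).trans ?_)
  norm_num

theorem sphere_pred {V : Type} {G : SimpleGraph V} {x w : V} {i : ℕ} (h : w ∈ sphere G x (i + 1)) :
    ∃ v ∈ sphere G x i, G.Adj v w := by
  have h' : G.edist w x = ((i + 1 : ℕ) : ℕ∞) := by rw [SimpleGraph.edist_comm]; exact h
  obtain ⟨p, hp⟩ := SimpleGraph.exists_walk_of_edist_ne_top
    (show G.edist w x ≠ ⊤ by rw [h']; exact ENat.natCast_ne_top _)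
  rw [h'] at hp
  have hp : p.length = i + 1 := by exact_mod_cast hp
  cases p with
  | nil => simp at hp
  | @cons _ v _ hadj p' =>
    refine ⟨v, ?_, hadj.symm⟩
    have h1 : G.edist v x ≤ (i : ℕ) := by
      have := SimpleGraph.edist_le p'
      have e : p'.length = i := by simpa using hp
      rwa [e] at this
    show G.edist x v = (i : ℕ)
    rw [SimpleGraph.edist_comm]
    refine le_antisymm h1 ?_
    by_contra hlt
    push Not at hlt
    obtain ⟨j, hj⟩ := ENat.ne_top_iff_exists.1 (ne_top_of_lt hlt)
    rw [← hj] at hlt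
    have hji : j < i := by exact_mod_cast hlt
    have h2 : G.edist x v ≤ (j : ℕ) := by rw [SimpleGraph.edist_comm, ← hj]
    have h3 := edist_adj_le hadj.symm h2
    rw [show G.edist x w = ((i + 1 : ℕ) : ℕ∞) from h] at h3
    have : i + 1 ≤ j + 1 := by exact_mod_cast h3
    omega

theorem sph_card_succ {V : Type} [Finite V] {G : SimpleGraph V} {x : V} {i m : ℕ}
    (h : ∀ v ∈ sphere G x i, deg G v ≤ m) : #(sph G x (i + 1)) ≤ #(sph G x i) * m := by
  classical
  have : sph G x (i + 1) ⊆ (sph G x i).biUnion (nb G) := by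
    intro w hw
    obtain ⟨v, hv, hvw⟩ := sphere_pred (mem_sph.1 hw)
    exact Finset.mem_biUnion.2 ⟨v, mem_sph.2 hv, mem_nb.2 hvw⟩
  refine (Finset.card_le_card this).trans (Finset.card_biUnion_le_card_mul _ _ _ fun v hv => ?_)
  rw [card_nb]
  exact h v (mem_sph.1 hv)

theorem sph_zero {V : Type} [Finite V] (G : SimpleGraph V) (x : V) : sph G x 0 = {x} := by
  ext v
  rw [mem_sph, Finset.mem_singleton]
  show G.edist x v = ((0 : ℕ) : ℕ∞) ↔ _
  rw [Nat.cast_zero, SimpleGraph.edist_eq_zero_iff, eq_comm]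

theorem deg_of_sphere {V : Type} {G : SimpleGraph V} {K : ℕ} (h1 : P1 K G) {x v : V} {i n : ℕ}
    (hi : i ≤ n) (hv : v ∈ sphere G x i) :
    deg G x ≤ deg G v + n * K ∧ deg G v ≤ deg G x + n * K := by
  rcases Nat.eq_zero_or_pos i with h0 | h0
  · subst h0
    have : v = x := by
      have : G.edist x v = ((0 : ℕ) : ℕ∞) := hv
      rw [Nat.cast_zero, SimpleGraph.edist_eq_zero_iff] at this
      exact this.symm
    subst this
    omega
  · have := h1 x i h0 v hv
    have h3 : K * i ≤ n * K := by rw [mul_comm]; exact Nat.mul_le_mul_right K hi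
    rw [abs_le] at this
    have e : ((K : ℤ) * i) = ((K * i : ℕ) : ℤ) := by push_cast; ring
    rw [e] at this
    omega

theorem sph_three {V : Type} [Finite V] {G : SimpleGraph V} {K : ℕ} (h1 : P1 K G) {x : V}
    (hd : 2 * K ≤ deg G x) : #(sph G x 3) ≤ 8 * deg G x ^ 3 := by
  have hs : ∀ i ≤ 2, ∀ v ∈ sphere G x i, deg G v ≤ 2 * deg G x := by
    intro i hi v hv
    have := deg_of_sphere h1 hi hv
    omega
  have a0 := sph_card_succ (hs 0 (by norm_num))
  have a1 := sph_card_succ (hs 1 (by norm_num))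
  have a2 := sph_card_succ (hs 2 (by norm_num))
  rw [sph_zero, Finset.card_singleton] at a0
  calc #(sph G x 3) ≤ #(sph G x 2) * (2 * deg G x) := a2
    _ ≤ (#(sph G x 1) * (2 * deg G x)) * (2 * deg G x) := by gcongr
    _ ≤ ((1 * (2 * deg G x)) * (2 * deg G x)) * (2 * deg G x) := by gcongr
    _ = 8 * deg G x ^ 3 := by ring

/-- Vertices in the sphere of radius `i` not infected in round `n`. -/
noncomputable def bad {V : Type} [Finite V] (G : SimpleGraph V) (A : Set V) (x : V) (i n : ℕ) :
    Finset V :=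
  (Set.toFinite (sphere G x i ∩ (bootIter G A n)ᶜ)).toFinset

theorem mem_bad {V : Type} [Finite V] {G : SimpleGraph V} {A : Set V} {x v : V} {i n : ℕ} :
    v ∈ bad G A x i n ↔ v ∈ sphere G x i ∧ v ∉ bootIter G A n := by
  simp [bad]

theorem exp_step {V : Type} [Finite V] {G : SimpleGraph V} {K : ℕ} (h1 : P1 K G) (h2 : P2 K G)
    {x : V} {A : Set V} {i n : ℕ} (hi : i ≤ 2) (hd : 12 * K ≤ deg G x) :
    #(bad G A x i (n + 1)) * deg G x ≤ 12 * K * #(bad G A x (i + 1) n) := by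
  classical
  set d := deg G x with hdd
  have key := Finset.card_mul_le_card_mul (s := bad G A x i (n + 1)) (t := bad G A x (i + 1) n)
    (fun v w => G.Adj v w) (m := (d + 3) / 4) (n := 3 * K) ?_ ?_
  · have : d ≤ 4 * ((d + 3) / 4) := by omega
    nlinarith
  · intro v hv
    obtain ⟨hv1, hv2⟩ := mem_bad.1 hv
    have hdv := (deg_of_sphere h1 hi hv1).1
    have hback : #((nb G v).filter (fun w => w ∈ ball G x i)) ≤ 2 * K := by
      rcases Nat.eq_zero_or_pos i with h0 | h0
      · subst h0
        rw [Finset.card_eq_zero.2, ]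
        · omega
        · rw [Finset.filter_eq_empty_iff]
          intro w hw hwb
          have e1 : G.edist x v = ((0 : ℕ) : ℕ∞) := hv1
          rw [Nat.cast_zero, SimpleGraph.edist_eq_zero_iff] at e1
          have e2 : G.edist x w ≤ ((0 : ℕ) : ℕ∞) := hwb
          rw [Nat.cast_zero, nonpos_iff_eq_zero, SimpleGraph.edist_eq_zero_iff] at e2
          have := mem_nb.1 hw
          rw [← e1, ← e2] at this
          exact G.loopless.irrefl _ this
      · have b1 := h2 x i h0 v hv1
        have b2 : #((nb G v).filter (fun w => w ∈ ball G x i)) ≤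
            (G.neighborSet v ∩ ball G x i).ncard := by
          apply card_le_ncard
          intro w hw
          obtain ⟨hw1, hw2⟩ := Finset.mem_filter.1 (Finset.mem_coe.1 hw)
          exact ⟨mem_nb.1 hw1, hw2⟩
        have b3 : K * i ≤ 2 * K := by rw [mul_comm]; exact Nat.mul_le_mul_right K hi
        omega
    have hinf : 2 * #((nb G v).filter (fun w => w ∈ bootIter G A n)) < deg G v := by
      have hv3 : v ∉ bootStep G (bootIter G A n) := hv2
      unfold bootStep at hv3
      simp only [Set.mem_union, Set.mem_ofPred_eq, not_or, not_le] at hv3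
      have b2 : #((nb G v).filter (fun w => w ∈ bootIter G A n)) ≤
            (G.neighborSet v ∩ bootIter G A n).ncard := by
          apply card_le_ncard
          intro w hw
          obtain ⟨hw1, hw2⟩ := Finset.mem_filter.1 (Finset.mem_coe.1 hw)
          exact ⟨mem_nb.1 hw1, hw2⟩
      have b3 := hv3.2
      rw [lt_div_iff₀ (by norm_num)] at b3
      have b4 : (G.neighborSet v ∩ bootIter G A n).ncard * 2 < deg G v := by exact_mod_cast b3
      omega
    have hsub : nb G v ⊆ bipartiteAbove (fun v w => G.Adj v w) (bad G A x (i + 1) n) v ∪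
        ((nb G v).filter (fun w => w ∈ ball G x i) ∪
          (nb G v).filter (fun w => w ∈ bootIter G A n)) := by
      intro w hw
      simp only [Finset.mem_union, Finset.mem_filter, Finset.mem_bipartiteAbove, mem_bad, hw,
        true_and, mem_nb.1 hw, and_true]
      by_cases hb : w ∈ ball G x i
      · exact Or.inr (Or.inl hb)
      by_cases hc : w ∈ bootIter G A n
      · exact Or.inr (Or.inr hc)
      refine Or.inl ⟨?_, hc⟩
      refine le_antisymm (edist_adj_le (mem_nb.1 hw) (le_of_eq hv1)) ?_
      have hlt : (i : ℕ∞) < G.edist x w := not_le.1 hb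
      have := Order.add_one_le_of_lt hlt
      exact_mod_cast this
    have c1 := (Finset.card_le_card hsub).trans (Finset.card_union_le _ _)
    have c2 := Finset.card_union_le ((nb G v).filter (fun w => w ∈ ball G x i))
      ((nb G v).filter (fun w => w ∈ bootIter G A n))
    rw [card_nb] at c1
    omega
  · intro w hw
    obtain ⟨hw1, hw2⟩ := mem_bad.1 hw
    have b1 := h2 x (i + 1) (by omega) w hw1
    have b3 : K * (i + 1) ≤ 3 * K := by rw [mul_comm]; exact Nat.mul_le_mul_right K (by omega)
    refine le_trans (card_le_ncard ?_) (b1.trans b3)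
    intro v hv
    rw [Finset.mem_coe, Finset.mem_bipartiteBelow] at hv
    refine ⟨hv.2.symm, ?_⟩
    refine le_trans (le_of_eq (mem_bad.1 hv.1).1) ?_
    exact_mod_cast Nat.le_succ i

theorem exp_all {V : Type} [Finite V] {G : SimpleGraph V} {K : ℕ} (h1 : P1 K G) (h2 : P2 K G)
    {x : V} {A : Set V} (hd : 12 * K ≤ deg G x) (hx : x ∉ bootIter G A 5) :
    deg G x ^ 3 ≤ (12 * K) ^ 3 * #(bad G A x 3 2) := by
  have a0 := exp_step h1 h2 (A := A) (i := 0) (n := 4) (by norm_num) hd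
  have a1 := exp_step h1 h2 (A := A) (i := 1) (n := 3) (by norm_num) hd
  have a2 := exp_step h1 h2 (A := A) (i := 2) (n := 2) (by norm_num) hd
  have hpos : 1 ≤ #(bad G A x 0 5) := by
    refine Finset.card_pos.2 ⟨x, mem_bad.2 ⟨?_, hx⟩⟩
    rw [← mem_sph, sph_zero]
    simp
  norm_num at a0 a1 a2
  set d := deg G x
  calc d ^ 3 = 1 * d * d * d := by ring
    _ ≤ #(bad G A x 0 5) * d * d * d := by gcongr
    _ ≤ (12 * K * #(bad G A x 1 4)) * d * d := by gcongr
    _ = 12 * K * (#(bad G A x 1 4) * d) * d := by ring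
    _ ≤ 12 * K * (12 * K * #(bad G A x 2 3)) * d := by gcongr
    _ = 12 * K * (12 * K * (#(bad G A x 2 3) * d)) := by ring
    _ ≤ 12 * K * (12 * K * (12 * K * #(bad G A x 3 2))) := by gcongr
    _ = _ := by ring

theorem colouring {V : Type} [DecidableEq V] (S : Finset V) (r : V → V → Prop)
    [∀ a, DecidablePred (r a)] (hr : ∀ a b, r a b → r b a) (Δ L M : ℕ) 
    (hL : 0 < L) (hΔ : ∀ y ∈ S, #(S.filter (r y)) ≤ Δ) (hM : Δ * L + #S < M * L) :
    ∃ f : V → ℕ, (∀ y ∈ S, f y < M) ∧ (∀ y ∈ S, ∀ z ∈ S, y ≠ z → f y = f z → ¬ r y z) ∧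
      ∀ m, #(S.filter (fun y => f y = m)) ≤ L := by
  suffices H : ∀ T : Finset V, T ⊆ S → ∃ f : V → ℕ, (∀ y ∈ T, f y < M) ∧
      (∀ y ∈ T, ∀ z ∈ T, y ≠ z → f y = f z → ¬ r y z) ∧
      ∀ m, #(T.filter (fun y => f y = m)) ≤ L from H S (Finset.Subset.refl S)
  intro T
  induction T using Finset.induction_on with
  | empty => exact fun _ => ⟨fun _ => 0, by simp, by simp, by simp⟩
  | insert a T ha ih =>
    intro hT
    have haS : a ∈ S := hT (Finset.mem_insert_self a T)
    have hTS : T ⊆ S := fun z hz => hT (Finset.mem_insert_of_mem hz)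
    obtain ⟨f, f1, f2, f3⟩ := ih hTS
    set F := (range M).filter (fun m => L ≤ #(T.filter (fun y => f y = m))) with hF
    have hFc : #F * L ≤ #S := by
      have e1 : #F * L ≤ ∑ m ∈ F, #(T.filter (fun y => f y = m)) := by
        rw [← smul_eq_mul]
        exact Finset.card_nsmul_le_sum _ _ _ fun m hm => (Finset.mem_filter.1 hm).2
      have e2 : ∑ m ∈ F, #(T.filter (fun y => f y = m)) ≤ #T := by
        rw [Finset.sum_card_fiberwise_eq_card_filter]
        exact Finset.card_filter_le _ _
      exact e1.trans (e2.trans (Finset.card_le_card hTS))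
    have hX : #((T.filter (r a)).image f ∪ F) < #(range M) := by
      rw [Finset.card_range]
      have e1 : #((T.filter (r a)).image f) ≤ Δ :=
        Finset.card_image_le.trans
          ((Finset.card_le_card (Finset.filter_subset_filter _ hTS)).trans (hΔ a haS))
      have e2 := Finset.card_union_le ((T.filter (r a)).image f) F
      by_contra hcon
      push Not at hcon
      have : M * L ≤ (Δ + #F) * L := Nat.mul_le_mul_right L (by omega)
      rw [add_mul] at this
      omega
    obtain ⟨m, hm, hmX⟩ := Finset.exists_mem_notMem_of_card_lt_card hX
    rw [Finset.mem_union, not_or] at hmX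
    obtain ⟨hm1, hm2⟩ := hmX
    have hne : ∀ z ∈ T, z ≠ a := fun z hz h => ha (h ▸ hz)
    have hupd : ∀ z ∈ T, Function.update f a m z = f z := fun z hz =>
      Function.update_of_ne (hne z hz) _ _
    have hconf : ∀ z ∈ T, f z = m → ¬ r a z := fun z hz hfz hraz =>
      hm1 (Finset.mem_image.2 ⟨z, Finset.mem_filter.2 ⟨hz, hraz⟩, hfz⟩)
    refine ⟨Function.update f a m, ?_, ?_, ?_⟩
    · intro y hy
      rcases Finset.mem_insert.1 hy with rfl | hy
      · rw [Function.update_self]; exact Finset.mem_range.1 hm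
      · rw [hupd y hy]; exact f1 y hy
    · intro y hy z hz hyz hf
      rcases Finset.mem_insert.1 hy with hya | hyT
      · rcases Finset.mem_insert.1 hz with hza | hzT
        · exact absurd (hya.trans hza.symm) hyz
        · rw [hya, Function.update_self, hupd z hzT] at hf
          rw [hya]
          exact hconf z hzT hf.symm
      · rcases Finset.mem_insert.1 hz with hza | hzT
        · rw [hza, Function.update_self, hupd y hyT] at hf
          rw [hza]
          exact fun h => hconf y hyT hf (hr _ _ h)
        · rw [hupd y hyT, hupd z hzT] at hf
          exact f2 y hyT z hzT hyz hf
    · intro m'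
      have e : T.filter (fun y => Function.update f a m y = m') = T.filter (fun y => f y = m') := by
        apply Finset.filter_congr
        intro z hz
        rw [hupd z hz]
      rw [Finset.filter_insert, e, Function.update_self]
      split_ifs with h
      · subst h
        have : ¬ L ≤ #(T.filter (fun y => f y = m)) := fun hh =>
          hm2 (Finset.mem_filter.2 ⟨hm, hh⟩)
        refine (Finset.card_insert_le _ _).trans ?_
        omega
      · exact f3 m'

theorem union_bound {V : Type} [Fintype V] [DecidableEq V] {G : SimpleGraph V} {p q : ℝ}
    (hp0 : 0 ≤ p) (hp1 : p ≤ 1) (hq0 : 0 ≤ q) (E : Finset V → Prop) (S : Finset V)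
    (f : V → ℕ) (M L k : ℕ) (hfM : ∀ y ∈ S, f y < M)
    (hconf : ∀ y ∈ S, ∀ z ∈ S, y ≠ z → f y = f z → z ∉ ball G y 5)
    (hL : ∀ m, #(S.filter (fun y => f y = m)) ≤ L)
    (hq : ∀ y ∈ S, Ex p univ (fun A : Finset V => ind (y ∉ bootIter G (↑A : Set V) 2)) ≤ q)
    (hE : ∀ A : Finset V, E A → ∃ B ⊆ S, (∀ y ∈ B, y ∉ bootIter G (↑A : Set V) 2) ∧
      M * (k - 1) < #B) :
    Ex p univ (fun A => ind (E A)) ≤ M * 2 ^ L * q ^ k := by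
  classical
  set cls : ℕ → Finset V := fun m => S.filter (fun y => f y = m) with hcls
  have hpt : ∀ A : Finset V, ind (E A) ≤ ∑ m ∈ range M, ∑ J ∈ (cls m).powersetCard k,
      ∏ y ∈ J, ind (y ∉ bootIter G (↑A : Set V) 2) := by
    intro A
    by_cases hA : E A
    · rw [ind_pos hA]
      obtain ⟨B, hBS, hB, hBc⟩ := hE A hA
      obtain ⟨m, hm, hmk⟩ : ∃ m ∈ range M, k - 1 < #(B.filter (fun y => f y = m)) := by
        refine Finset.exists_lt_card_fiber_of_mul_lt_card_of_maps_to
          (fun y hy => Finset.mem_range.2 (hfM y (hBS hy))) ?_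
        rw [Finset.card_range]; exact hBc
      obtain ⟨J, hJ, hJk⟩ := Finset.exists_subset_card_eq (show k ≤ #(B.filter (fun y => f y = m)) by omega)
      have hJm : J ∈ (cls m).powersetCard k := by
        refine Finset.mem_powersetCard.2 ⟨fun y hy => ?_, hJk⟩
        obtain ⟨y1, y2⟩ := Finset.mem_filter.1 (hJ hy)
        exact Finset.mem_filter.2 ⟨hBS y1, y2⟩
      have h1 : ∏ y ∈ J, ind (y ∉ bootIter G (↑A : Set V) 2) = 1 :=
        Finset.prod_eq_one fun y hy => ind_pos (hB y (Finset.mem_filter.1 (hJ hy)).1)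
      rw [← h1]
      have nn : ∀ J : Finset V, 0 ≤ ∏ y ∈ J, ind (y ∉ bootIter G (↑A : Set V) 2) := fun J =>
        Finset.prod_nonneg fun y _ => ind_nonneg _
      refine le_trans (Finset.single_le_sum (f := fun J : Finset V =>
        ∏ y ∈ J, ind (y ∉ bootIter G (↑A : Set V) 2)) (fun J _ => nn J) hJm) ?_
      exact Finset.single_le_sum (f := fun m => ∑ J ∈ (cls m).powersetCard k,
        ∏ y ∈ J, ind (y ∉ bootIter G (↑A : Set V) 2))
        (fun m _ => Finset.sum_nonneg fun J _ => nn J) hm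
    · rw [ind_neg hA]
      exact Finset.sum_nonneg fun m _ => Finset.sum_nonneg fun J _ =>
        Finset.prod_nonneg fun y _ => ind_nonneg _
  refine (Ex_mono hp0 hp1 _ hpt).trans ?_
  rw [Ex_sum]
  have hm : ∀ m ∈ range M, Ex p univ (fun A : Finset V => ∑ J ∈ (cls m).powersetCard k,
      ∏ y ∈ J, ind (y ∉ bootIter G (↑A : Set V) 2)) ≤ 2 ^ L * q ^ k := by
    intro m _
    rw [Ex_sum]
    have hJ : ∀ J ∈ (cls m).powersetCard k, Ex p univ (fun A : Finset V =>
        ∏ y ∈ J, ind (y ∉ bootIter G (↑A : Set V) 2)) ≤ q ^ k := by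
      intro J hJ
      obtain ⟨hJ1, hJ2⟩ := Finset.mem_powersetCard.1 hJ
      rw [Ex_prod p J (fun y => bl G y 2)
        (fun y (A : Finset V) => ind (y ∉ bootIter G (↑A : Set V) 2)) (fun y _ => Loc_boot G y)]
      · rw [← hJ2]
        rw [← Finset.prod_const]
        refine Finset.prod_le_prod (fun y _ => Ex_nonneg hp0 hp1 _ fun A => ind_nonneg _) ?_
        exact fun y hy => hq y (Finset.mem_filter.1 (hJ1 hy)).1
      · intro y hy z hz hyz
        obtain ⟨y1, y2⟩ := Finset.mem_filter.1 (hJ1 hy)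
        obtain ⟨z1, z2⟩ := Finset.mem_filter.1 (hJ1 hz)
        exact bl_disjoint (hconf y y1 z z1 hyz (y2.trans z2.symm))
    refine (Finset.sum_le_card_nsmul _ _ _ hJ).trans ?_
    rw [nsmul_eq_mul]
    refine mul_le_mul_of_nonneg_right ?_ (pow_nonneg hq0 k)
    have : #((cls m).powersetCard k) ≤ 2 ^ L := by
      refine (Finset.card_le_card (t := (cls m).powerset) fun J hJ => ?_).trans ?_
      · exact Finset.mem_powerset.2 (Finset.mem_powersetCard.1 hJ).1
      · rw [Finset.card_powerset]
        exact Nat.pow_le_pow_right (by norm_num) (hL m)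
    exact_mod_cast this
  refine (Finset.sum_le_card_nsmul _ _ _ hm).trans ?_
  rw [Finset.card_range, nsmul_eq_mul, mul_assoc]

theorem final_num {N R d k : ℕ} (hR : 0 < R) (hd : N + 6 ≤ d) (hk : d ≤ R * k) :
    ((N * d ^ 2 : ℕ) : ℝ) * 2 ^ d * Real.exp (-(4 * R)) ^ k ≤ Real.exp (-(1 * (d : ℝ))) := by
  have hN : (N : ℝ) ≤ d := by exact_mod_cast (by omega : N ≤ d)
  have h6 : (6 : ℝ) ≤ d := by exact_mod_cast (by omega : 6 ≤ d)
  have e1 : (N * d ^ 2 : ℝ) ≤ Real.exp d * Real.exp d := by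
    have a := Real.pow_div_factorial_le_exp (d : ℝ) (by positivity) 3
    have b := Real.add_one_le_exp (d : ℝ)
    have c : (6 : ℝ) ≤ Real.exp d := by linarith
    have : ((3 : ℕ).factorial : ℝ) = 6 := by norm_num [Nat.factorial]
    rw [this, div_le_iff₀ (by norm_num)] at a
    calc (N * d ^ 2 : ℝ) ≤ d * d ^ 2 := by gcongr
      _ = (d : ℝ) ^ 3 := by ring
      _ ≤ Real.exp d * 6 := a
      _ ≤ _ := by gcongr
  have e2 : (2 : ℝ) ^ d ≤ Real.exp d := by
    have : (2 : ℝ) ≤ Real.exp 1 := by linarith [Real.add_one_le_exp (1 : ℝ)]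
    calc (2 : ℝ) ^ d ≤ Real.exp 1 ^ d := by gcongr
      _ = Real.exp d := by rw [← Real.exp_nat_mul, mul_one]
  have e3 : Real.exp (-(4 * R)) ^ k ≤ Real.exp (-(4 * d)) := by
    rw [← Real.exp_nat_mul]
    apply Real.exp_le_exp.2
    have : (d : ℝ) ≤ R * k := by exact_mod_cast hk
    linarith
  push_cast
  calc (N * d ^ 2 : ℝ) * 2 ^ d * Real.exp (-(4 * R)) ^ k
      ≤ (Real.exp d * Real.exp d) * Real.exp d * Real.exp (-(4 * d)) := by gcongr
    _ = Real.exp (-(1 * (d : ℝ))) := by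
      rw [← Real.exp_add, ← Real.exp_add, ← Real.exp_add]
      congr 1
      ring

theorem main_bound (K : ℕ) {c : ℝ} (hc0 : 0 < c) (hc : c < 1 / 2) :
    ∃ D₀ : ℕ, 1 ≤ D₀ ∧ ∀ (V : Type) [Fintype V] [DecidableEq V] (G : SimpleGraph V),
      P1 K G → P2 K G → P3 K G → ∀ x : V, D₀ ≤ deg G x →
      Ex (1 / 2 - c * sg (deg G x)) univ
        (fun A : Finset V => ind (x ∉ bootIter G (↑A : Set V) 5)) ≤
          Real.exp (-(1 * (deg G x : ℝ))) := by
  obtain ⟨C, hC⟩ : ∃ C, C = (12 * K) ^ 3 + 1 := ⟨_, rfl⟩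
  obtain ⟨N, hN⟩ : ∃ N, N = 3 * K ^ 2 + 9 := ⟨_, rfl⟩
  obtain ⟨R, hR⟩ : ∃ R, R = 4 * C * N := ⟨_, rfl⟩
  have hC0 : 0 < C := by omega
  have hN0 : 0 < N := by omega
  have hR0 : 0 < R := by rw [hR]; positivity
  obtain ⟨D₁, hD₁⟩ := eventually_atTop.1 ((local_bound K hc0 hc
    (Real.exp_pos (-(4 * R)))).and (mul_sg_lt_ev c (show (0 : ℝ) < 1 / 8 by norm_num)))
  refine ⟨D₁ + 12 * K + 2 * C * K ^ 2 + N + 6, by omega, ?_⟩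
  intro V _ _ G h1 h2 h3 x hx
  obtain ⟨d, hd⟩ : ∃ d, d = deg G x := ⟨_, rfl⟩
  rw [← hd] at hx ⊢
  obtain ⟨hloc, hδ⟩ := hD₁ d (by omega)
  have hδ0 : 0 ≤ c * sg d := mul_nonneg hc0.le (sg_nonneg d)
  obtain ⟨D, hxD, hD⟩ := h3 x
  obtain ⟨dA, -, -, dB⟩ := hD 3 (by norm_num)
  rw [← hd] at dA dB
  norm_num at dA dB
  classical
  set S := (sph G x 3).filter (fun v => v ∉ D) with hS
  have hSc : #S ≤ 8 * d ^ 3 := by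
    rw [hd]
    exact (Finset.card_filter_le _ _).trans (sph_three h1 (by omega))
  have hd0 : 0 < d := by omega
  have hd3 : 0 < d ^ 3 := by positivity
  obtain ⟨f, f1, f2, f3⟩ := colouring S (fun y z => z ∈ ball G y 5)
    (by
      intro a b hab
      show G.edist b a ≤ _
      rw [SimpleGraph.edist_comm]; exact hab) (3 * K ^ 2 * d ^ 2) d (N * d ^ 2) hd0
    (by
      intro y hy
      obtain ⟨y1, y2⟩ := Finset.mem_filter.1 hy
      refine le_trans (card_le_ncard ?_) (dB y (mem_sph.1 y1) y2)
      intro z hz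
      obtain ⟨z1, z2⟩ := Finset.mem_filter.1 (Finset.mem_coe.1 hz)
      obtain ⟨z3, z4⟩ := Finset.mem_filter.1 z1
      exact ⟨z2, mem_sph.1 z3, z4⟩)
    (by
      have : N * d ^ 2 * d = 3 * K ^ 2 * d ^ 2 * d + 9 * d ^ 3 := by rw [hN]; ring
      omega)
  refine (union_bound (q := Real.exp (-(4 * R))) (k := d / R + 1) (by linarith) (by linarith)
    (Real.exp_pos _).le (fun A => x ∉ bootIter G (↑A : Set V) 5) S f (N * d ^ 2) d f1 f2 f3
    ?_ ?_).trans ?_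
  · intro y hy
    have := deg_of_sphere h1 le_rfl (mem_sph.1 (Finset.mem_filter.1 hy).1)
    rw [← hd] at this
    exact hloc V G h1 h2 h3 y this.1 this.2
  · intro A hA
    refine ⟨(bad G (↑A : Set V) x 3 2).filter (fun v => v ∉ D), ?_, ?_, ?_⟩
    · intro v hv
      obtain ⟨v1, v2⟩ := Finset.mem_filter.1 hv
      exact Finset.mem_filter.2 ⟨mem_sph.2 (mem_bad.1 v1).1, v2⟩
    · intro v hv
      exact (mem_bad.1 (Finset.mem_filter.1 hv).1).2
    · have hexp := exp_all h1 h2 (by omega) hA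
      rw [← hd] at hexp
      have hsplit := Finset.card_filter_add_card_filter_not (s := bad G (↑A : Set V) x 3 2)
        (fun v => v ∉ D)
      have hDc : #((bad G (↑A : Set V) x 3 2).filter (fun v => ¬ v ∉ D)) ≤ K ^ 2 * d ^ 2 := by
        refine le_trans (card_le_ncard ?_) dA
        intro v hv
        obtain ⟨v1, v2⟩ := Finset.mem_filter.1 (Finset.mem_coe.1 hv)
        exact ⟨not_not.1 v2, (mem_bad.1 v1).1⟩
      set g := #((bad G (↑A : Set V) x 3 2).filter (fun v => v ∉ D)) with hg
      set b := #(bad G (↑A : Set V) x 3 2) with hb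
      have t1 : d ^ 3 ≤ C * b := hexp.trans (Nat.mul_le_mul_right _ (by omega))
      have t2 : b ≤ g + K ^ 2 * d ^ 2 := by omega
      have t3 : C * b ≤ C * g + C * (K ^ 2 * d ^ 2) := by
        rw [← mul_add]; exact Nat.mul_le_mul_left C t2
      have t4 : 2 * C * K ^ 2 * d ^ 2 ≤ d * d ^ 2 := Nat.mul_le_mul_right _ (by omega)
      have t5 : d * d ^ 2 = d ^ 3 := by ring
      have t6 : 2 * C * K ^ 2 * d ^ 2 = 2 * (C * (K ^ 2 * d ^ 2)) := by ring
      have t7 : d ^ 3 ≤ 2 * (C * g) := by omega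
      rw [Nat.add_sub_cancel]
      by_contra hcon
      push Not at hcon
      have t8 : R * (d / R) ≤ d := Nat.mul_div_le d R
      have t9 : 4 * (C * g) ≤ 4 * (C * (N * d ^ 2 * (d / R))) := by gcongr
      have t10 : 4 * (C * (N * d ^ 2 * (d / R))) = (R * (d / R)) * d ^ 2 := by rw [hR]; ring
      have t11 : (R * (d / R)) * d ^ 2 ≤ d * d ^ 2 := Nat.mul_le_mul_right _ t8
      omega
  · refine final_num hR0 (by omega) ?_
    have := Nat.lt_mul_div_succ d hR0
    omega

theorem deg_of_card_one {V : Type} (G : SimpleGraph V) (h : Nat.card V = 1) (x : V) :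
    deg G x = 0 := by
  haveI := (Nat.card_eq_one_iff_unique.1 h).1
  have : G.neighborSet x = ∅ := by
    ext v
    simp only [SimpleGraph.mem_neighborSet, Set.mem_empty_iff_false, iff_false]
    intro hv
    exact hv.ne (Subsingleton.elim x v)
  rw [deg, this, Set.ncard_empty]

end Global

/-- Lemma: exponential bound after five rounds. -/
theorem statement5 (K : ℕ) (c : ℝ) (hc0 : 0 < c) (hc : c < 1 / 2) :
    ∃ β : ℝ, 0 < β ∧ ∃ D₀ : ℕ, ∀ (V : Type) [Finite V], ∀ G : SimpleGraph V,
      InH K G → D₀ ≤ minDeg G → ∀ x : V,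
      prob (1 / 2 - c * Real.sqrt (Real.log (deg G x) / (deg G x)))
          (fun A0 => x ∉ bootIter G A0 5)
        ≤ Real.exp (-(β * (deg G x : ℝ))) := by
  obtain ⟨D₀, hD1, hD⟩ := main_bound K hc0 hc
  refine ⟨1, one_pos, D₀, ?_⟩
  intro V _ G hG hmin x
  classical
  haveI := Fintype.ofFinite V
  have hx : D₀ ≤ deg G x := hmin.trans (Nat.sInf_le ⟨x, rfl⟩)
  have hone : Nat.card V ≠ 1 := by
    intro h
    have := deg_of_card_one G h x
    omega
  obtain ⟨n, hn⟩ := hG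
  cases n with
  | zero => exact absurd hn hone
  | succ n =>
    rcases hn with hn | ⟨h1, h2, h3, -, -⟩
    · exact absurd hn hone
    · rw [prob_eq']
      exact hD V G h1 h2 h3 x hx

end MBP
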